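/- Let q be a prime power with q ≡ 3 (mod 4) and q ≥ 7, of characteristic p, let n be an integer with 3 ≤ n ≤ p, and let e be an even divisor of q−1. Then N_n(e) ≥ θ(e)^n · (q − ((n−1)/2) W(e)^n √q). -/

import Mathlib

open Finset

/-- An element `g` of a finite field is primitive if it generates the multiplicative
group of nonzero elements, i.e. every nonzero element is a power of `g`. -/
def IsPrimitiveElem {F : Type*} [Field F] (g : F) : Prop :=
  ∀ x : F, x ≠ 0 → ∃ k : ℕ, g ^ k = x

/-- The field `F` contains `n` consecutive distinct primitive elements: there is `g`
such that `g, g+1, …, g+n-1` are `n` distinct primitive elements. -/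
def HasConsecutivePrimitives (F : Type*) [Field F] (n : ℕ) : Prop :=
  ∃ g : F, (∀ k : ℕ, k < n → IsPrimitiveElem (g + (k : F))) ∧
    ∀ i : ℕ, i < n → ∀ j : ℕ, j < n → g + (i : F) = g + (j : F) → i = j

/-- A nonzero element `g` is `e`-free if `g = h ^ d` with `d ∣ e` forces `d = 1`. -/
def EFree {F : Type*} [Field F] (e : ℕ) (g : F) : Prop :=
  g ≠ 0 ∧ ∀ (h : F) (d : ℕ), d ∣ e → g = h ^ d → d = 1

/-- `Ncount F n e` is the number `N(e₁, …, eₙ)` of `g ∈ F` such that `g + k - 1`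
is `eₖ`-free for each `k = 1, …, n`. -/
noncomputable def Ncount (F : Type*) [Field F] (n : ℕ) (e : Fin n → ℕ) : ℕ :=
  Nat.card {g : F // ∀ k : Fin n, EFree (e k) (g + ((k : ℕ) : F))}

/-- `Nn F n e = N(e, …, e)` counts `g ∈ F` with `g, g+1, …, g+n-1` all `e`-free. -/
noncomputable def Nn (F : Type*) [Field F] (n e : ℕ) : ℕ :=
  Ncount F n (fun _ => e)

/-- `θ(m) = ∏_{ℓ ∣ m, ℓ prime} (1 - 1/ℓ)`. -/
noncomputable def theta (m : ℕ) : ℝ :=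
  ∏ l ∈ m.primeFactors, (1 - 1 / (l : ℝ))

/-- `W(m) = 2^{ω(m)}`, the number of squarefree divisors of `m`. -/
def W (m : ℕ) : ℕ := 2 ^ m.primeFactors.card

theorem kummer_lowDegree_ne_zero {K E L : Type*} [Field K] [Field E] [Field L]
    [Algebra (Polynomial K) E] [IsFractionRing (Polynomial K) E]
    [Algebra E L] [IsAlgClosed L] {d : ℕ} {f : Polynomial K} (hf0 : f ≠ 0)
    (hf : ∀ k : ℕ, (∀ c : K, d ∣ k * f.rootMultiplicity c) → d ∣ k) {κ : K} (hκ : κ ≠ 0)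
    {y : L} (hy : y ^ d = algebraMap E L (algebraMap (Polynomial K) E (Polynomial.C κ) /
        algebraMap (Polynomial K) E f))
    {P : Polynomial (Polynomial K)} (hP0 : P ≠ 0) (hPd : P.natDegree < d) :
    Polynomial.eval₂ ((algebraMap E L).comp (algebraMap (Polynomial K) E)) y P ≠ 0 := by
  intro hroot
  have hinj : Function.Injective (algebraMap (Polynomial K) E) :=
    IsFractionRing.injective _ _
  obtain ⟨a, ha⟩ : ∃ a : E, a = algebraMap (Polynomial K) E (Polynomial.C κ) /
    algebraMap (Polynomial K) E f := ⟨_, rfl⟩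
  rw [← ha] at hy
  have hP'0 : P.map (algebraMap (Polynomial K) E) ≠ 0 := (Polynomial.map_ne_zero_iff hinj).2 hP0
  have hP'root : Polynomial.aeval y (P.map (algebraMap (Polynomial K) E)) = 0 := by
    rw [Polynomial.aeval_def, Polynomial.eval₂_map]; exact hroot
  have hy_int : IsIntegral E y := by
    have : IsAlgebraic E y := ⟨_, hP'0, hP'root⟩
    exact this.isIntegral
  obtain ⟨μ, hμ⟩ : ∃ μ, μ = minpoly E y := ⟨_, rfl⟩
  have hkpos : 0 < μ.natDegree := hμ ▸ minpoly.natDegree_pos hy_int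
  have hkd : μ.natDegree < d := by
    have h1 := Polynomial.natDegree_le_of_dvd (minpoly.dvd E y hP'root) hP'0
    rw [Polynomial.natDegree_map_eq_of_injective hinj P, ← hμ] at h1
    omega
  have hμdvd : μ ∣ Polynomial.X ^ d - Polynomial.C a := by
    rw [hμ]
    apply minpoly.dvd
    simp [hy]
  have hsplit : (μ.map (algebraMap E L)).Splits := IsAlgClosed.splits _
  have hmonic : (μ.map (algebraMap E L)).Monic := by
    rw [hμ]; exact (minpoly.monic hy_int).map _
  have hc : algebraMap E L (μ.coeff 0) =
      (-1) ^ μ.natDegree * (μ.map (algebraMap E L)).roots.prod := by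
    have := hsplit.coeff_zero_eq_prod_roots_of_monic hmonic
    rwa [Polynomial.coeff_map, Polynomial.natDegree_map] at this
  have hcard : (μ.map (algebraMap E L)).roots.card = μ.natDegree := by
    rw [← hsplit.natDegree_eq_card_roots, Polynomial.natDegree_map]
  have hprod : (μ.map (algebraMap E L)).roots.prod ^ d = algebraMap E L a ^ μ.natDegree := by
    have h1 : ∀ ρ ∈ (μ.map (algebraMap E L)).roots, ρ ^ d = algebraMap E L a := by
      intro ρ hρ
      have h2 := (Polynomial.mem_roots'.1 hρ).2
      have h3 : (Polynomial.X ^ d - Polynomial.C (algebraMap E L a)).IsRoot ρ := by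
        have := Polynomial.map_dvd (algebraMap E L) hμdvd
        refine h2.dvd ?_
        simpa using this
      simpa [sub_eq_zero] using h3
    calc _ = ((μ.map (algebraMap E L)).roots.map (fun ρ => ρ ^ d)).prod := by
          rw [Multiset.prod_map_pow, Multiset.map_id']
      _ = ((μ.map (algebraMap E L)).roots.map (fun _ => algebraMap E L a)).prod := by
          rw [Multiset.map_congr rfl h1]
      _ = _ := by rw [Multiset.map_const', Multiset.prod_replicate, hcard]
  have hw : (μ.coeff 0) ^ d = (-1) ^ (μ.natDegree * d) * a ^ μ.natDegree := by
    apply (algebraMap E L).injective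
    rw [map_pow, hc, mul_pow, hprod]
    simp [pow_mul]
  obtain ⟨g, h, hh, hgh⟩ := IsFractionRing.div_surjective (A := Polynomial K) (μ.coeff 0)
  have hh0 : h ≠ 0 := nonZeroDivisors.ne_zero hh
  obtain ⟨k, hk⟩ : ∃ k, k = μ.natDegree := ⟨_, rfl⟩
  have hcne : (-1) ^ (k * d) * κ ^ k ≠ 0 := 
    mul_ne_zero (pow_ne_zero _ (by simp)) (pow_ne_zero _ hκ)
  have hkey : g ^ d * f ^ k = Polynomial.C ((-1) ^ (k * d) * κ ^ k) * h ^ d := by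
    apply hinj
    have hf1 : algebraMap (Polynomial K) E f ≠ 0 := by
      rwa [Ne, FaithfulSMul.algebraMap_eq_zero_iff]
    have hh1 : algebraMap (Polynomial K) E h ≠ 0 := by
      rwa [Ne, FaithfulSMul.algebraMap_eq_zero_iff]
    rw [← hgh, ha, div_pow, div_pow, ← hk, ← mul_div_assoc,
      div_eq_div_iff (pow_ne_zero _ hh1) (pow_ne_zero _ hf1)] at hw
    simp only [map_mul, map_pow, map_neg, map_one] at hw ⊢
    rw [hw]
  have hg0 : g ≠ 0 := by
    rintro rfl
    apply mul_ne_zero (Polynomial.C_ne_zero.2 hcne) (pow_ne_zero d hh0)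
    rw [← hkey, zero_pow (by omega), zero_mul]
  have hdk := hf k (fun c => by
    classical
    have h1 := congrArg (fun p => p.roots.count c) hkey
    rw [Polynomial.roots_mul (mul_ne_zero (pow_ne_zero _ hg0) (pow_ne_zero _ hf0)),
      Polynomial.roots_C_mul _ hcne, Multiset.count_add] at h1
    simp only [Polynomial.roots_pow, Multiset.count_nsmul, Polynomial.count_roots] at h1
    exact (Nat.dvd_add_right (dvd_mul_right d _)).1 (h1 ▸ dvd_mul_right d _))
  exact absurd (Nat.le_of_dvd (hk ▸ hkpos) hdk) (by omega)

theorem Polynomial.natDegree_coeff_mul_le {K : Type*} [Semiring K]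
    {P Q : Polynomial (Polynomial K)} {a b : ℕ} (hP : ∀ k, (P.coeff k).natDegree ≤ a)
    (hQ : ∀ k, (Q.coeff k).natDegree ≤ b) (k : ℕ) : ((P * Q).coeff k).natDegree ≤ a + b := by
  rw [Polynomial.coeff_mul]
  exact Polynomial.natDegree_sum_le_of_forall_le _ _ fun x _ =>
    Polynomial.natDegree_mul_le_of_le (hP _) (hQ _)

theorem Polynomial.natDegree_coeff_prod_le {K : Type*} [CommSemiring K]
    {P : ℕ → Polynomial (Polynomial K)} {a : ℕ} (hP : ∀ i k, ((P i).coeff k).natDegree ≤ a)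
    (d k : ℕ) : ((∏ i ∈ Finset.range d, P i).coeff k).natDegree ≤ d * a := by
  induction d generalizing k with
  | zero =>
    rw [Finset.prod_range_zero, Polynomial.coeff_one]
    split_ifs <;> simp
  | succ d ih =>
    rw [Finset.prod_range_succ, add_one_mul]
    exact Polynomial.natDegree_coeff_mul_le ih (hP d) k

theorem coeff_prod_rotate_eq_zero {K : Type*} [Field K] {d : ℕ} {ζ : K}
    (hζ : IsPrimitiveRoot ζ d) (P : Polynomial (Polynomial K)) {k : ℕ} (hk : ¬ d ∣ k) :
    (∏ i ∈ range d, P.comp (Polynomial.C (Polynomial.C (ζ ^ i)) * Polynomial.X)).coeff k = 0 := by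
  obtain ⟨N, hN⟩ : ∃ N, N = ∏ i ∈ range d,
    P.comp (Polynomial.C (Polynomial.C (ζ ^ i)) * Polynomial.X) := ⟨_, rfl⟩
  have h1 : N.comp (Polynomial.C (Polynomial.C ζ) * Polynomial.X) = N := by
    rw [hN, Polynomial.prod_comp]
    have h2 : ∀ i, (P.comp (Polynomial.C (Polynomial.C (ζ ^ i)) * Polynomial.X)).comp
        (Polynomial.C (Polynomial.C ζ) * Polynomial.X) =
        P.comp (Polynomial.C (Polynomial.C (ζ ^ (i + 1))) * Polynomial.X) := by
      intro i
      rw [Polynomial.comp_assoc]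
      congr 1
      simp [pow_succ, mul_assoc]
    simp only [h2]
    have h3 := prod_range_succ
      (fun i => P.comp (Polynomial.C (Polynomial.C (ζ ^ i)) * Polynomial.X)) d
    have h4 := prod_range_succ'
      (fun i => P.comp (Polynomial.C (Polynomial.C (ζ ^ i)) * Polynomial.X)) d
    by_cases hP : P.comp (Polynomial.C (Polynomial.C (ζ ^ 0)) * Polynomial.X) = 0
    · have : P = 0 := by simpa using hP
      simp [this]
    · rw [h4, hζ.pow_eq_one, ← pow_zero ζ] at h3
      exact mul_right_cancel₀ hP h3
  have h5 := congrArg (fun Q => Polynomial.coeff Q k) h1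
  simp only [Polynomial.comp_C_mul_X_coeff, ← Polynomial.C_pow] at h5
  rw [← hN]
  by_contra hne
  have h6 : (Polynomial.C (ζ ^ k) : Polynomial K) = 1 :=
    mul_left_cancel₀ hne (by rw [h5, mul_one])
  rw [← Polynomial.C_1] at h6
  exact hk (hζ.dvd_of_pow_eq_one k (Polynomial.C_injective h6))

theorem eval₂_eq_sum_of_coeff_eq_zero {R S : Type*} [CommSemiring R] [CommSemiring S]
    (φ : R →+* S) {N : Polynomial R} {d : ℕ} (hd : 0 < d) (hN : ∀ k, ¬ d ∣ k → N.coeff k = 0)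
    (hdeg : N.natDegree ≤ d * (d - 1)) (x : S) :
    N.eval₂ φ x = ∑ j ∈ range d, φ (N.coeff (d * j)) * (x ^ d) ^ j := by
  have hlt : N.natDegree < d * (d - 1) + 1 := by omega
  rw [Polynomial.eval₂_eq_sum_range' φ hlt]
  symm
  have h1 : ∑ j ∈ range d, φ (N.coeff (d * j)) * (x ^ d) ^ j =
      ∑ k ∈ (range d).image (d * ·), φ (N.coeff k) * x ^ k := by
    rw [sum_image (by intro a _ b _ h; exact Nat.eq_of_mul_eq_mul_left hd h)]
    simp only [pow_mul]
  rw [h1]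
  apply sum_subset
  · intro k hk
    obtain ⟨j, hj, rfl⟩ := mem_image.1 hk
    rw [mem_range] at hj ⊢
    exact Nat.lt_succ_of_le (Nat.mul_le_mul_left d (by omega))
  · intro k hk hk'
    rw [hN k, map_zero, zero_mul]
    rintro ⟨j, rfl⟩
    apply hk'
    rw [mem_image]
    refine ⟨j, ?_, rfl⟩
    rw [mem_range] at hk ⊢
    have := Nat.le_of_mul_le_mul_left (Nat.lt_succ_iff.1 hk) hd
    omega

theorem not_pow_dvd_eval_pow {K : Type*} [Field K] {p t d u a : ℕ} [Fact p.Prime]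
    [CharP K p] (hd : 0 < d) (hdu : d * u + 1 = p ^ t) {ζ : K} (hζ : IsPrimitiveRoot ζ d)
    {f : Polynomial K} (hf : ∀ k : ℕ, (∀ c : K, d ∣ k * f.rootMultiplicity c) → d ∣ k)
    {c : K} (hc : f.eval c ≠ 0) {P : Polynomial (Polynomial K)} (hP0 : P ≠ 0)
    (hPd : P.natDegree < d) (hPa : ∀ k, (P.coeff k).natDegree ≤ a)
    (hlt : d * a + (d - 1) * f.natDegree < p ^ t) :
    ¬ (Polynomial.X - Polynomial.C c) ^ p ^ t ∣ P.eval (f ^ u) := by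
  intro hdvd
  have hf0 : f ≠ 0 := by rintro rfl; simp at hc
  obtain ⟨V, hV⟩ : ∃ V, V = (Polynomial.X - Polynomial.C c) ^ p ^ t := ⟨_, rfl⟩
  obtain ⟨κ, hκ⟩ : ∃ κ, κ = f.eval c ^ p ^ t := ⟨_, rfl⟩
  have hκ0 : κ ≠ 0 := by rw [hκ]; exact pow_ne_zero _ hc
  have hVf : V ∣ f ^ p ^ t - Polynomial.C κ := by
    have : f ^ p ^ t - Polynomial.C κ = (f - Polynomial.C (f.eval c)) ^ p ^ t := by
      rw [sub_pow_char_pow, hκ, Polynomial.C_pow]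
    rw [this, hV]
    exact pow_dvd_pow_of_dvd (Polynomial.X_sub_C_dvd_sub_C_eval) _
  obtain ⟨N, hN⟩ : ∃ N, N = ∏ i ∈ range d,
    P.comp (Polynomial.C (Polynomial.C (ζ ^ i)) * Polynomial.X) := ⟨_, rfl⟩
  have hNz : ∀ k, ¬ d ∣ k → N.coeff k = 0 := fun k hk => by
    rw [hN]; exact coeff_prod_rotate_eq_zero hζ P hk
  have hNa : ∀ k, (N.coeff k).natDegree ≤ d * a := by
    intro k
    rw [hN]
    apply Polynomial.natDegree_coeff_prod_le
    intro i k
    rw [Polynomial.comp_C_mul_X_coeff, ← Polynomial.C_pow]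
    refine (Polynomial.natDegree_mul_C_le _ _).trans (hPa k)
  have hNd : N.natDegree ≤ d * (d - 1) := by
    rw [hN]
    refine (Polynomial.natDegree_prod_le _ _).trans ?_
    refine (sum_le_card_nsmul _ _ (d - 1) ?_).trans (by simp)
    intro i _
    refine Polynomial.natDegree_comp_le.trans ?_
    calc _ ≤ P.natDegree * 1 := Nat.mul_le_mul_left _
          ((Polynomial.natDegree_C_mul_le _ _).trans Polynomial.natDegree_X_le)
      _ ≤ d - 1 := by omega
  obtain ⟨M, hM⟩ : ∃ M : Polynomial K, M = ∑ j ∈ range d,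
    N.coeff (d * j) * (Polynomial.C κ ^ j * f ^ (d - 1 - j)) := ⟨_, rfl⟩
  have hMdeg : M.natDegree ≤ d * a + (d - 1) * f.natDegree := by
    rw [hM]
    refine Polynomial.natDegree_sum_le_of_forall_le _ _ fun j hj => ?_
    refine Polynomial.natDegree_mul_le_of_le (hNa _) ?_
    rw [← Polynomial.C_pow]
    refine (Polynomial.natDegree_C_mul_le _ _).trans ?_
    refine Polynomial.natDegree_pow_le.trans (Nat.mul_le_mul_right _ (by omega))
  have hVN : V ∣ N.eval (f ^ u) := by
    rw [hN, Polynomial.eval_prod]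
    refine Dvd.dvd.trans ?_ (dvd_prod_of_mem _ (mem_range.2 hd))
    rw [hV]
    simpa using hdvd
  have hVM : V ∣ M := by
    have h1 : V ∣ f ^ (d - 1) * N.eval (f ^ u) - M := by
      rw [Polynomial.eval, eval₂_eq_sum_of_coeff_eq_zero _ hd hNz hNd, hM, mul_sum,
        ← sum_sub_distrib]
      refine dvd_sum fun j hj => ?_
      have hj' : d - 1 = (d - 1 - j) + j := by have := mem_range.1 hj; omega
      have h2 : f ^ (d - 1) * (RingHom.id _ (N.coeff (d * j)) * ((f ^ u) ^ d) ^ j) -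
          N.coeff (d * j) * (Polynomial.C κ ^ j * f ^ (d - 1 - j)) =
          N.coeff (d * j) * f ^ (d - 1 - j) * ((f ^ p ^ t) ^ j - Polynomial.C κ ^ j) := by
        rw [← hdu, hj', Nat.add_sub_cancel, RingHom.id_apply]; ring
      rw [h2]
      exact ((hVf.trans (sub_dvd_pow_sub_pow _ _ j))).mul_left _
    exact (dvd_sub_right (hVN.mul_left _)).1 h1
  have hM0 : M = 0 := by
    by_contra hne
    have h1 := Polynomial.natDegree_le_of_dvd hVM hne
    rw [hV, Polynomial.natDegree_pow, Polynomial.natDegree_X_sub_C, mul_one] at h1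
    omega
  let E := RatFunc K
  let L := AlgebraicClosure E
  obtain ⟨y, hy⟩ := IsAlgClosed.exists_pow_nat_eq (algebraMap E L
    (algebraMap (Polynomial K) E (Polynomial.C κ) / algebraMap (Polynomial K) E f)) hd
  obtain ⟨φ, hφ⟩ : ∃ φ, φ = (algebraMap E L).comp (algebraMap (Polynomial K) E) := ⟨_, rfl⟩
  have hφf : φ f ≠ 0 := by
    rw [hφ]
    simpa using hf0
  have hyf : y ^ d * φ f = φ (Polynomial.C κ) := by
    rw [hy, hφ, RingHom.comp_apply, ← map_mul, div_mul_cancel₀, RingHom.comp_apply]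
    simpa using hf0
  have hNy : N.eval₂ φ y = 0 := by
    have h1 : φ f ^ (d - 1) * N.eval₂ φ y = φ M := by
      rw [eval₂_eq_sum_of_coeff_eq_zero _ hd hNz hNd, hM, mul_sum, map_sum]
      refine sum_congr rfl fun j hj => ?_
      have hj' : d - 1 = (d - 1 - j) + j := by have := mem_range.1 hj; omega
      rw [map_mul, map_mul, map_pow, map_pow, ← hyf]
      conv_lhs => rw [hj']
      ring
    rw [hM0, map_zero] at h1
    exact (mul_eq_zero.1 h1).resolve_left (pow_ne_zero _ hφf)
  rw [hN, Polynomial.eval₂_finsetProd] at hNy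
  obtain ⟨i, _, hi⟩ := prod_eq_zero_iff.1 hNy
  rw [Polynomial.eval₂_comp, Polynomial.eval₂_mul, Polynomial.eval₂_C, Polynomial.eval₂_X] at hi
  refine kummer_lowDegree_ne_zero (E := E) (L := L) (y := φ (Polynomial.C (ζ ^ i)) * y) hf0 hf hκ0 ?_
    hP0 hPd ?_
  · rw [mul_pow, hy, ← map_pow, ← Polynomial.C_pow, ← pow_mul, mul_comm i d, pow_mul,
      hζ.pow_eq_one, one_pow, Polynomial.C_1, map_one, one_mul]
  · rw [← hφ]
    exact hi

theorem exists_relation_of_natDegree_lt {K I : Type*} [Field K] [Fintype I] {M : ℕ}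
    (v : I → Polynomial K) (hv : ∀ i, v i ∈ Polynomial.degreeLT K M) (hM : M < Fintype.card I) :
    ∃ w : I → K, ∑ i, Polynomial.C (w i) * v i = 0 ∧ ∃ i, w i ≠ 0 := by
  have hli : ¬ LinearIndependent K (fun i => (⟨v i, hv i⟩ : Polynomial.degreeLT K M)) := by
    intro h
    have : Module.Finite K (Polynomial.degreeLT K M) :=
      Module.Finite.equiv (Polynomial.degreeLTEquiv K M).symm
    have h1 := h.fintype_card_le_finrank
    rw [(Polynomial.degreeLTEquiv K M).finrank_eq, Module.finrank_fin_fun] at h1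
    omega
  obtain ⟨w, hw, i, hi⟩ := Fintype.not_linearIndependent_iff.1 hli
  refine ⟨w, ?_, i, hi⟩
  have := congrArg Subtype.val hw
  simpa [Polynomial.smul_eq_C_mul] using this

theorem dvd_of_sum_mul_pow_eq_zero {R : Type*} [CommRing R] [IsDomain R] {J : ℕ} {V : R}
    (hV : V ≠ 0) {q : Fin J → R} (hq : ∑ j, q j * V ^ (j : ℕ) = 0) (j₀ : Fin J)
    (h0 : ∀ j < j₀, q j = 0) : V ∣ q j₀ := by
  have h1 : V ^ ((j₀ : ℕ) + 1) ∣ ∑ j ∈ univ.erase j₀, q j * V ^ (j : ℕ) := by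
    refine dvd_sum fun j hj => ?_
    rcases lt_trichotomy j j₀ with h | h | h
    · rw [h0 j h, zero_mul]; exact dvd_zero _
    · exact absurd h (ne_of_mem_erase hj)
    · exact (pow_dvd_pow V h).mul_left _
  rw [← add_sum_erase _ _ (mem_univ j₀)] at hq
  have h2 := (dvd_add_left h1).1 (hq ▸ dvd_zero _)
  rw [pow_succ, mul_comm (q j₀)] at h2
  exact (mul_dvd_mul_iff_left (pow_ne_zero _ hV)).1 h2

theorem stepanov_card_le {K : Type*} [Field K] [Fintype K] [DecidableEq K] {p t d u : ℕ}
    [Fact p.Prime] [CharP K p] (hK : Fintype.card K = (p ^ t) ^ 2) (hd : 0 < d)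
    (hdu : d * u + 1 = p ^ t) {ζ : K} (hζ : IsPrimitiveRoot ζ d) {f : Polynomial K}
    (hf : ∀ k : ℕ, (∀ c : K, d ∣ k * f.rootMultiplicity c) → d ∣ k)
    {c : K} (hc : f.eval c ≠ 0) (a : K) {A J : ℕ}
    (hA : d * A + (d - 1) * f.natDegree < p ^ t)
    (hJ : A * p ^ t + (d - 1) * u * f.natDegree + J + 1 < d * (J + 1) * (A + 1)) :
    #{x : K | f.eval x ≠ 0 ∧ f.eval x ^ (u * (p ^ t + 1)) = a} ≤
      A + (d - 1) * u * f.natDegree + J * p ^ t := by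
  obtain ⟨r, hr⟩ : ∃ r, r = p ^ t := ⟨_, rfl⟩
  have hV0 : (Polynomial.X - Polynomial.C c) ^ p ^ t ≠ 0 :=
    pow_ne_zero _ (Polynomial.X_sub_C_ne_zero c)
  let v : (Fin d × Fin (J + 1)) × Fin (A + 1) → Polynomial K := fun z =>
    Polynomial.C (a ^ (z.1.1 : ℕ)) * (Polynomial.X ^ (z.2 * r) * f ^ ((d - 1 - z.1.1) * u) *
      (Polynomial.X - Polynomial.C c) ^ (z.1.2 : ℕ))
  obtain ⟨w, hw, z₀, hz₀⟩ := exists_relation_of_natDegree_lt (M := A * r + (d - 1) * u * f.natDegree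
      + J + 1) v (by
    intro z
    rw [Polynomial.mem_degreeLT]
    refine lt_of_le_of_lt Polynomial.degree_le_natDegree ?_
    rw [Nat.cast_lt, Nat.lt_succ_iff]
    refine (Polynomial.natDegree_C_mul_le _ _).trans ?_
    refine Polynomial.natDegree_mul_le_of_le (Polynomial.natDegree_mul_le_of_le ?_ ?_) ?_
    · rw [Polynomial.natDegree_X_pow]
      exact Nat.mul_le_mul_right _ (by omega)
    · refine Polynomial.natDegree_pow_le.trans ?_
      exact Nat.mul_le_mul_right _ (Nat.mul_le_mul_right _ (Nat.sub_le _ _))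
    · refine Polynomial.natDegree_pow_le.trans ?_
      rw [Polynomial.natDegree_X_sub_C]
      omega) (by simpa [hr] using hJ)
  let P : Fin (J + 1) → Polynomial (Polynomial K) := fun j =>
    Polynomial.ofFn d fun s => Polynomial.ofFn (A + 1) fun i => w ((s, j), i) ^ r
  let R : Polynomial K := ∑ j, (P j).eval (f ^ u) * ((Polynomial.X - Polynomial.C c) ^ p ^ t) ^ (j : ℕ)
  have hPd : ∀ j, (P j).natDegree < d := fun j => Polynomial.ofFn_natDegree_lt hd _
  have hPa : ∀ j k, ((P j).coeff k).natDegree ≤ A := by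
    intro j k
    by_cases hk : k < d
    · rw [Polynomial.ofFn_coeff_eq_val_of_lt _ hk]
      exact Nat.lt_succ_iff.1 (Polynomial.ofFn_natDegree_lt (by omega) _)
    · rw [Polynomial.ofFn_coeff_eq_zero_of_ge _ (not_lt.1 hk)]
      simp
  have hR0 : R ≠ 0 := by
    intro hR
    have hall : ∀ j, P j = 0 := by
      intro j
      induction j using WellFoundedLT.induction with
      | ind j ih =>
        by_contra hne
        refine not_pow_dvd_eval_pow hd hdu hζ hf hc hne (hPd j) (hPa j) hA ?_
        exact dvd_of_sum_mul_pow_eq_zero hV0 hR j fun j' hj' => by rw [ih j' hj']; simp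
    apply hz₀
    have h1 := congrArg (fun Q => (Q.coeff (z₀.1.1 : ℕ)).coeff (z₀.2 : ℕ)) (hall z₀.1.2)
    simp only [P] at h1
    rw [Polynomial.ofFn_coeff_eq_val_of_lt _ z₀.1.1.2,
      Polynomial.ofFn_coeff_eq_val_of_lt _ z₀.2.2] at h1
    simpa using eq_zero_of_pow_eq_zero h1
  have hRdeg : R.natDegree ≤ A + (d - 1) * u * f.natDegree + J * p ^ t := by
    refine Polynomial.natDegree_sum_le_of_forall_le _ _ fun j _ => ?_
    refine Polynomial.natDegree_mul_le_of_le ?_ ?_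
    · rw [Polynomial.eval_eq_sum_range' (hPd j)]
      refine Polynomial.natDegree_sum_le_of_forall_le _ _ fun s hs => ?_
      refine Polynomial.natDegree_mul_le_of_le (hPa j s) ?_
      rw [← pow_mul, mul_comm (d - 1)]
      refine Polynomial.natDegree_pow_le.trans ?_
      have := mem_range.1 hs
      gcongr
      omega
    · rw [← pow_mul, mul_comm]
      refine Polynomial.natDegree_pow_le.trans ?_
      rw [Polynomial.natDegree_X_sub_C, mul_one]
      gcongr
      omega
  refine le_trans (Polynomial.card_le_degree_of_subset_roots (p := R) ?_) hRdeg
  intro x hx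
  rw [mem_val, mem_filter] at hx
  obtain ⟨-, hx0, hxa⟩ := hx
  rw [Polynomial.mem_roots hR0, Polynomial.IsRoot]
  have hQ : ∀ z : K, (z ^ r) ^ r = z := by
    intro z
    rw [← pow_mul, ← sq, hr, ← hK, FiniteField.pow_card]
  have hReval : R.eval x = ∑ j : Fin (J + 1), ∑ s : Fin d, ∑ i : Fin (A + 1), 
      w ((s, j), i) ^ r * x ^ (i : ℕ) * (f.eval x ^ u) ^ (s : ℕ) * ((x - c) ^ r) ^ (j : ℕ) := by
    simp only [R, P, Polynomial.ofFn_eq_sum_monomial, Polynomial.eval_finsetSum,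
      Polynomial.eval_mul, Polynomial.eval_monomial, Polynomial.eval_pow, sum_mul,
      Polynomial.eval_sub, Polynomial.eval_X, Polynomial.eval_C, ← hr]
  have hpow : R.eval x ^ r * f.eval x ^ ((d - 1) * u) = 0 := by
    have h2 := congrArg (Polynomial.eval x) hw
    simp only [v, Polynomial.eval_finsetSum, Polynomial.eval_mul, Polynomial.eval_C,
      Polynomial.eval_pow, Polynomial.eval_X, Polynomial.eval_sub, Polynomial.eval_zero] at h2
    rw [Fintype.sum_prod_type, Fintype.sum_prod_type, sum_comm] at h2
    rw [← h2, hReval, hr, sum_pow_char_pow, sum_mul]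
    refine sum_congr rfl fun j _ => ?_
    rw [sum_pow_char_pow, sum_mul]
    refine sum_congr rfl fun s _ => ?_
    rw [sum_pow_char_pow, sum_mul]
    refine sum_congr rfl fun i _ => ?_
    rw [← hr] at hxa ⊢
    have hs : d - 1 = (d - 1 - s) + s := by have := s.2; omega
    have h3 : (f.eval x ^ u) ^ ((s : ℕ) * r) * f.eval x ^ ((d - 1) * u) =
        a ^ (s : ℕ) * f.eval x ^ ((d - 1 - s) * u) := by
      rw [← hxa, ← pow_mul, ← pow_mul, ← pow_add, ← pow_add]
      congr 1
      conv_lhs => rw [hs]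
      ring
    calc _ = (w ((s, j), i) ^ r) ^ r * x ^ (i * r : ℕ) * (((x - c) ^ r) ^ r) ^ (j : ℕ) *
          ((f.eval x ^ u) ^ ((s : ℕ) * r) * f.eval x ^ ((d - 1) * u)) := by ring
      _ = _ := by rw [h3, hQ, hQ]; ring
  exact eq_zero_of_pow_eq_zero ((mul_eq_zero.1 hpow).resolve_right (pow_ne_zero _ hx0))

theorem mul_card_filter_pow_eq_le {K : Type*} [Field K] [Fintype K] [DecidableEq K] {p t d u : ℕ}
    [Fact p.Prime] [CharP K p] (hK : Fintype.card K = (p ^ t) ^ 2) (hd : 0 < d)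
    (hdu : d * u + 1 = p ^ t) {ζ : K} (hζ : IsPrimitiveRoot ζ d) {f : Polynomial K}
    (hf : ∀ k : ℕ, (∀ c : K, d ∣ k * f.rootMultiplicity c) → d ∣ k)
    {c : K} (hc : f.eval c ≠ 0) (a : K) :
    d * #{x : K | f.eval x ≠ 0 ∧ f.eval x ^ (u * (p ^ t + 1)) = a} ≤
      (p ^ t) ^ 2 + 4 * (f.natDegree + 1) * (d + 1) ^ 2 * p ^ t := by
  obtain ⟨D, hD⟩ : ∃ D, D = f.natDegree := ⟨_, rfl⟩
  obtain ⟨r, hr⟩ : ∃ r, r = p ^ t := ⟨_, rfl⟩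
  have hd1 : d = (d - 1) + 1 := by omega
  obtain ⟨b, hb⟩ : ∃ b, b = d - 1 := ⟨_, rfl⟩
  rw [← hb] at hd1
  by_cases hu : 1 ≤ u ∧ 2 * D ≤ u
  · obtain ⟨hu1, hu2⟩ := hu
    obtain ⟨A, hA⟩ : ∃ A, u = A + D := ⟨u - D, by omega⟩
    have h1 := stepanov_card_le hK hd hdu hζ hf hc a (A := A) (J := u + 2 * D + 1)
      (by
        rw [← hD, ← hdu, ← hb, hA, hd1]
        nlinarith)
      (by
        rw [← hD, ← hdu, ← hb, hd1]
        have h2 : u ≤ 2 * A := by omega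
        have h3 : 1 ≤ A := by omega
        have h4 := Nat.mul_le_mul_left (b * D) h2
        have h5 := Nat.mul_le_mul_left D h2
        nlinarith)
    rw [← hD, ← hr, ← hb] at h1
    rw [← hD, ← hr]
    rw [← hr] at hdu
    refine (Nat.mul_le_mul_left d h1).trans ?_
    have e1 : d * (A + b * u * D + (u + 2 * D + 1) * r) =
      d * A + b * D * (d * u) + (d * u) * r + d * (2 * D + 1) * r := by ring
    have e2 : d * A ≤ r := by rw [← hdu, hA]; nlinarith
    have e3 : b * D * (d * u) ≤ d * D * r :=
      Nat.mul_le_mul (Nat.mul_le_mul_right _ (by omega)) (by omega)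
    have e4 : (d * u) * r ≤ r ^ 2 := by rw [sq]; exact Nat.mul_le_mul_right _ (by omega)
    have e5 : r + d * D * r + d * (2 * D + 1) * r ≤ 4 * (D + 1) * (d + 1) ^ 2 * r := by
      have : 1 + d * D + d * (2 * D + 1) ≤ 4 * (D + 1) * (d + 1) ^ 2 := by
        have : d * D ≤ d ^ 2 * D + d * D := by omega
        nlinarith
      calc _ = (1 + d * D + d * (2 * D + 1)) * r := by ring
        _ ≤ _ := Nat.mul_le_mul_right _ this
    omega
  · have h1 : #{x : K | f.eval x ≠ 0 ∧ f.eval x ^ (u * (p ^ t + 1)) = a} ≤ r ^ 2 := by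
      rw [hr, ← hK]; exact card_le_univ _
    rw [← hr] at hdu h1 ⊢
    rw [← hD]
    have h2 : u ≤ 2 * D + 1 := by omega
    have h3 : d * r ≤ 4 * (D + 1) * (d + 1) ^ 2 := by
      have := Nat.mul_le_mul_left (d * d) h2
      have h6 : d ≤ d * d := Nat.le_mul_self d
      rw [← hdu]; nlinarith
    calc _ ≤ d * r ^ 2 := Nat.mul_le_mul_left _ h1
      _ = d * r * r := by ring
      _ ≤ 4 * (D + 1) * (d + 1) ^ 2 * r := Nat.mul_le_mul_right _ h3
      _ ≤ _ := Nat.le_add_left _ _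

theorem norm_sum_pow_mul_card_le {d : ℕ} {N : ℕ → ℕ}
    {M C : ℝ} {η : ℂ} (hd : 0 < d) (hη : η ^ d = 1) (hη1 : η ≠ 1)
    (hN : ∀ i < d, (d : ℝ) * N i ≤ M) (hsum : M - ∑ i ∈ range d, (N i : ℝ) ≤ C) :
    ‖∑ i ∈ range d, η ^ i * (N i : ℂ)‖ ≤ C := by
  have hgeom : ∑ i ∈ range d, η ^ i = 0 := by
    have := mul_geom_sum η d
    rw [hη, sub_self] at this
    exact (mul_eq_zero.mp this).resolve_left (sub_ne_zero.mpr hη1)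
  have hnorm : ‖η‖ = 1 := Complex.norm_eq_one_of_pow_eq_one hη hd.ne'
  have hd' : (0 : ℝ) < d := by exact_mod_cast hd
  have key : (d : ℂ) * ∑ i ∈ range d, η ^ i * (N i : ℂ) =
      ∑ i ∈ range d, η ^ i * (((d * N i - M : ℝ)) : ℂ) := by
    push_cast
    simp_rw [mul_sub]
    rw [sum_sub_distrib, ← sum_mul, hgeom, zero_mul, sub_zero, mul_sum]
    exact sum_congr rfl fun i _ => by ring
  have h2 : (d : ℝ) * ‖∑ i ∈ range d, η ^ i * (N i : ℂ)‖ ≤ d * C := by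
    calc (d : ℝ) * ‖∑ i ∈ range d, η ^ i * (N i : ℂ)‖
        = ‖(d : ℂ) * ∑ i ∈ range d, η ^ i * (N i : ℂ)‖ := by simp
      _ ≤ ∑ i ∈ range d, ‖η ^ i * (((d * N i - M : ℝ)) : ℂ)‖ := by
          rw [key]; exact norm_sum_le _ _
      _ = ∑ i ∈ range d, (M - d * N i) := by
          refine sum_congr rfl fun i hi => ?_
          rw [norm_mul, norm_pow, hnorm, one_pow, one_mul, Complex.norm_real, Real.norm_eq_abs,
            abs_of_nonpos (sub_nonpos.mpr (hN i (mem_range.mp hi))), neg_sub]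
      _ = d * (M - ∑ i ∈ range d, (N i : ℝ)) := by
          rw [sum_sub_distrib, ← mul_sum]; simp; ring
      _ ≤ d * C := by gcongr
  exact le_of_mul_le_mul_left h2 hd'

theorem norm_sum_mulChar_norm_le {F K : Type*} [Field F] [Fintype F] [Field K] [Fintype K]
    [Algebra F K] {χ : MulChar F ℂ} {d : ℕ} (hd : d ∣ Fintype.card F - 1) (hχd : χ ^ d = 1)
    (hχ : χ ≠ 1) {k : ℕ} (hK : Fintype.card K = (Fintype.card F ^ k) ^ 2)
    {f : Polynomial F}
    (hf : ∀ j : ℕ, (∀ c : K, d ∣ j * (f.map (algebraMap F K)).rootMultiplicity c) → d ∣ j) :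
    ‖∑ x : K, χ (Algebra.norm F (Polynomial.aeval x f))‖ ≤
      (4 * (f.natDegree + 1) * (d + 1) ^ 2 + f.natDegree : ℕ) * (Fintype.card F : ℝ) ^ k := by
  classical
  set g := f.map (algebraMap F K) with hg
  have hgeval : ∀ x : K, Polynomial.aeval x f = g.eval x := fun x => by
    rw [hg, Polynomial.eval_map, Polynomial.aeval_def]
  simp_rw [hgeval]
  have hdeg : g.natDegree = f.natDegree := Polynomial.natDegree_map _
  by_cases hex : ∃ c, g.eval c ≠ 0
  swap
  · push Not at hex
    simp only [hex, Algebra.norm_zero, MulChar.map_zero, sum_const_zero, norm_zero]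
    positivity
  obtain ⟨c, hc⟩ := hex
  obtain ⟨p, _, n, hp, hcard⟩ := FiniteField.card' F
  have : Fact p.Prime := ⟨hp⟩
  have : CharP K p := charP_of_injective_algebraMap (algebraMap F K).injective p
  obtain ⟨v, hv⟩ := hd
  have hq1 : 1 < Fintype.card F := Fintype.one_lt_card
  have hq : Fintype.card F = d * v + 1 := by omega
  have hdv : 0 < d * v := by omega
  have hd0 : 0 < d := Nat.pos_of_mul_pos_right hdv
  obtain ⟨w, hw⟩ : ∃ w, Fintype.card F ^ k = d * v * w + 1 := by
    obtain ⟨w, hw⟩ := Nat.sub_one_dvd_pow_sub_one (Fintype.card F) k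
    refine ⟨w, ?_⟩
    rw [← hv, ← hw]
    have : 0 < Fintype.card F ^ k := by positivity
    omega
  have hr : Fintype.card F ^ k = p ^ (n * k : ℕ) := by rw [hcard, pow_mul]
  have hr2 : (p ^ (n * k : ℕ)) ^ 2 - 1 = d * v * (w * (p ^ (n * k : ℕ) + 1)) := by
    rw [← hr, hw]
    refine Nat.sub_eq_of_eq_add ?_
    ring
  obtain ⟨γ, hγ⟩ := IsCyclic.exists_monoid_generator (α := Fˣ)
  have hγord : orderOf γ = d * v := by
    rw [orderOf_eq_card_of_forall_mem_powers hγ, Nat.card_eq_fintype_card, Fintype.card_units, hv]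
  set ζ : K := algebraMap F K ((γ ^ v : Fˣ) : F) with hζdef
  have hζ : IsPrimitiveRoot ζ d := by
    have h1 : IsPrimitiveRoot (γ ^ v) d :=
      (IsPrimitiveRoot.orderOf γ).pow (by omega) (by rw [hγord, mul_comm])
    exact ((IsPrimitiveRoot.coe_units_iff).mpr h1).map_of_injective (algebraMap F K).injective
  set N : ℕ → ℕ := fun i => #{x : K | g.eval x ≠ 0 ∧
    g.eval x ^ (v * w * (p ^ (n * k : ℕ) + 1)) = ζ ^ i} with hN
  have hbound := fun i => mul_card_filter_pow_eq_le (K := K) (p := p) (t := n * k) (d := d)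
    (u := v * w) (by rw [hK, hr]) hd0 (by rw [← hr, hw, mul_assoc]) hζ hf hc (ζ ^ i)
  set η : ℂ := χ γ with hη
  have hηd : η ^ d = 1 := by
    rw [hη, ← MulChar.pow_apply_coe, hχd, MulChar.one_apply_coe]
  have hη1 : η ≠ 1 := by
    intro h
    refine hχ (MulChar.eq_one_iff.mpr fun a => ?_)
    obtain ⟨i, rfl⟩ := hγ a
    simp [← hη, h]
  have hpow : ∀ y : K, y ≠ 0 → ∃ i < d, χ (Algebra.norm F y) = η ^ i ∧
      y ^ (v * w * (p ^ (n * k : ℕ) + 1)) = ζ ^ i := by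
    intro y hy
    have hny : Algebra.norm F y ≠ 0 := Algebra.norm_ne_zero_iff.mpr hy
    obtain ⟨i, hi⟩ := hγ (Units.mk0 _ hny)
    have hi' : ((γ : F)) ^ i = Algebra.norm F y := by
      have := congrArg (Units.val) hi
      simpa using this
    refine ⟨i % d, Nat.mod_lt _ hd0, ?_, ?_⟩
    · rw [← hi', map_pow, ← hη, ← pow_eq_pow_mod i hηd]
    · have h1 : algebraMap F K (Algebra.norm F y) = y ^ (w * (p ^ (n * k : ℕ) + 1)) := by
        rw [FiniteField.algebraMap_norm_eq_pow, Nat.card_eq_fintype_card,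
          Nat.card_eq_fintype_card, hK, hr, hr2, hv, Nat.mul_div_cancel_left _ hdv]
      rw [← pow_eq_pow_mod i hζ.pow_eq_one, mul_assoc, mul_comm, pow_mul, ← h1, ← hi',
        hζdef]
      push_cast
      ring
  have hdecomp : ∀ x : K, χ (Algebra.norm F (g.eval x)) = ∑ i ∈ range d,
      if g.eval x ≠ 0 ∧ g.eval x ^ (v * w * (p ^ (n * k : ℕ) + 1)) = ζ ^ i then η ^ i else 0 := by
    intro x
    by_cases hx : g.eval x = 0
    · simp [hx, Algebra.norm_zero, MulChar.map_zero]
    · obtain ⟨i, hi, h1, h2⟩ := hpow _ hx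
      rw [h1, sum_eq_single i]
      · rw [if_pos ⟨hx, h2⟩]
      · intro j hj hji
        rw [if_neg]
        rintro ⟨-, h⟩
        rw [h2] at h
        exact hji (hζ.pow_inj (mem_range.mp hj) hi h.symm)
      · exact fun h => absurd (mem_range.mpr hi) h
  have hcover : (Fintype.card K : ℝ) - f.natDegree ≤ ∑ i ∈ range d, (N i : ℝ) := by
    have h1 : #{x : K | g.eval x ≠ 0} ≤ ∑ i ∈ range d, N i := by
      refine (card_le_card fun x hx => ?_).trans card_biUnion_le
      obtain ⟨i, hi, -, h2⟩ := hpow _ (mem_filter.mp hx).2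
      simp only [mem_biUnion, mem_range, mem_filter, mem_univ, true_and]
      exact ⟨i, hi, (mem_filter.mp hx).2, h2⟩
    have hg0 : g ≠ 0 := by
      rintro h
      simp [h] at hc
    have h2 : #{x : K | g.eval x = 0} ≤ f.natDegree := by
      rw [← hdeg]
      refine (card_le_card fun x hx => ?_).trans
        ((Multiset.toFinset_card_le _).trans (Polynomial.card_roots' g))
      simpa [hg0] using hx
    have h3 := card_filter_add_card_filter_not (s := (univ : Finset K)) (fun x => g.eval x = 0)
    rw [card_univ] at h3
    have h4 : Fintype.card K ≤ f.natDegree + ∑ i ∈ range d, N i := by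
      rw [← h3]
      exact add_le_add h2 h1
    have h5 : (Fintype.card K : ℝ) ≤ f.natDegree + ∑ i ∈ range d, (N i : ℝ) := by exact_mod_cast h4
    linarith
  have hS : ∑ x : K, χ (Algebra.norm F (g.eval x)) = ∑ i ∈ range d, η ^ i * (N i : ℂ) := by
    simp_rw [hdecomp]
    rw [sum_comm]
    refine sum_congr rfl fun i _ => ?_
    rw [← sum_filter, sum_const, nsmul_eq_mul, mul_comm]
  rw [hS]
  refine norm_sum_pow_mul_card_le (M := ((Fintype.card F : ℝ) ^ k) ^ 2 +
    4 * (f.natDegree + 1) * (d + 1) ^ 2 * (Fintype.card F : ℝ) ^ k) hd0 hηd hη1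
    (fun i _ => ?_) ?_
  · have := hbound i
    rw [hdeg] at this
    change d * N i ≤ _ at this
    rw [← hr] at this
    exact_mod_cast this
  · have hKr : (Fintype.card K : ℝ) = ((Fintype.card F : ℝ) ^ k) ^ 2 := by exact_mod_cast hK
    have h1 : (1 : ℝ) ≤ (Fintype.card F : ℝ) ^ k := one_le_pow₀ (by exact_mod_cast hq1.le)
    have h2 : (f.natDegree : ℝ) ≤ f.natDegree * (Fintype.card F : ℝ) ^ k :=
      le_mul_of_one_le_right (Nat.cast_nonneg _) h1
    rw [hKr] at hcover
    push_cast
    linarith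

theorem exists_le_forall_norm_pow_le_re_pow (s : Finset ℂ) (N : ℕ) :
    ∃ k, N ≤ k ∧ ∀ z ∈ s, ‖z‖ ^ k ≤ 2 * (z ^ k).re := by
  classical
  let u : ℕ → (s → ℂ) := fun n z => ((z : ℂ) / ‖(z : ℂ)‖) ^ n
  have hu1 : ∀ z : ℂ, ‖z / ‖z‖‖ ≤ 1 := fun z => by
    rw [norm_div, Complex.norm_real, norm_norm]
    exact div_self_le_one _
  have hu : ∀ n, u n ∈ Metric.closedBall (0 : s → ℂ) 1 := fun n => by
    rw [mem_closedBall_zero_iff, pi_norm_le_iff_of_nonneg zero_le_one]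
    intro z
    rw [norm_pow]
    exact pow_le_one₀ (norm_nonneg _) (hu1 _)
  obtain ⟨a, -, φ, hφ, hlim⟩ := tendsto_subseq_of_bounded Metric.isBounded_closedBall hu
  obtain ⟨M, hM⟩ := Metric.cauchySeq_iff'.mp hlim.cauchySeq (1 / 2) (by norm_num)
  have hge : φ M + (N + 1) ≤ φ (M + (N + 1)) := by
    have := hφ.add_le_nat (N + 1) M
    rwa [add_comm, add_comm M]
  refine ⟨φ (M + (N + 1)) - φ M, by omega, fun z hz => ?_⟩
  set k := φ (M + (N + 1)) - φ M with hk
  have hk0 : k ≠ 0 := by omega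
  rcases eq_or_ne z 0 with rfl | hz0
  · simp [hk0]
  set w : ℂ := z / ‖z‖ with hw
  have hzn : (0 : ℝ) < ‖z‖ := norm_pos_iff.mpr hz0
  have hwn : ‖w‖ = 1 := by
    rw [hw, norm_div, Complex.norm_real, norm_norm, div_self hzn.ne']
  have hzw : z = ‖z‖ * w := by
    rw [hw, mul_div_cancel₀]
    exact_mod_cast hzn.ne'
  have hd : ‖w ^ k - 1‖ < 1 / 2 := by
    have h1 := hM (M + (N + 1)) (by omega)
    have h2 := (dist_pi_lt_iff (by norm_num)).mp h1 ⟨z, hz⟩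
    have h3 : dist (w ^ φ (M + (N + 1))) (w ^ φ M) < 1 / 2 := h2
    have h4 : w ^ φ (M + (N + 1)) - w ^ φ M = w ^ φ M * (w ^ k - 1) := by
      rw [mul_sub, ← pow_add, mul_one, hk, Nat.add_sub_cancel' (by omega)]
    rwa [dist_eq_norm, h4, norm_mul, norm_pow, hwn, one_pow, one_mul] at h3
  have hre : 1 / 2 ≤ (w ^ k).re := by
    have := (Complex.abs_re_le_norm (w ^ k - 1)).trans hd.le
    rw [Complex.sub_re, Complex.one_re, abs_le] at this
    linarith [this.1]
  have hzk : (z ^ k).re = ‖z‖ ^ k * (w ^ k).re := by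
    conv_lhs => rw [hzw, mul_pow, ← Complex.ofReal_pow, Complex.re_ofReal_mul]
  rw [hzk]
  nlinarith [pow_pos hzn k]

theorem norm_le_of_forall_norm_sum_pow_le {s : Multiset ℂ} {C R : ℝ} (hR : 0 < R)
    (h : ∀ k, 0 < k → ‖(s.map (· ^ k)).sum‖ ≤ C * R ^ k) {z : ℂ} (hz : z ∈ s) : ‖z‖ ≤ R := by
  classical
  by_contra! hlt
  have h1 : 1 < ‖z‖ / R := (one_lt_div hR).mpr hlt
  obtain ⟨N, hN⟩ := pow_unbounded_of_one_lt (2 * C) h1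
  obtain ⟨k, hk, hre⟩ := exists_le_forall_norm_pow_le_re_pow s.toFinset (N + 1)
  have h2 : ‖z‖ ^ k ≤ 2 * ‖(s.map (· ^ k)).sum‖ := by
    have h3 : ‖z‖ ^ k ≤ (s.map (fun z => ‖z‖ ^ k)).sum :=
      Multiset.single_le_sum (by simp only [Multiset.mem_map]; rintro _ ⟨y, -, rfl⟩; positivity) _
        (Multiset.mem_map_of_mem _ hz)
    have h4 : (s.map (fun z => ‖z‖ ^ k)).sum ≤ (s.map (fun z => 2 * (z ^ k).re)).sum :=
      Multiset.sum_map_le_sum_map _ _ fun y hy => hre y (Multiset.mem_toFinset.mpr hy)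
    have h5 : (s.map (fun z => 2 * (z ^ k).re)).sum = 2 * ((s.map (· ^ k)).sum).re := by
      rw [Multiset.sum_map_mul_left]
      congr 1
      have := map_multiset_sum Complex.reAddGroupHom (s.map (· ^ k))
      rw [Multiset.map_map] at this
      exact this.symm
    have h6 := Complex.re_le_norm (s.map (· ^ k)).sum
    linarith
  have h7 : (‖z‖ / R) ^ k ≤ 2 * C := by
    rw [div_pow, div_le_iff₀ (pow_pos hR k)]
    linarith [h k (by omega)]
  have h8 : (‖z‖ / R) ^ N ≤ (‖z‖ / R) ^ k := pow_le_pow_right₀ h1.le (by omega)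
  linarith

theorem Polynomial.exists_eq_prod_one_sub_mul_X {P : Polynomial ℂ} (h0 : P.coeff 0 = 1) :
    ∃ s : Multiset ℂ, s.card ≤ P.natDegree ∧
      P = (s.map fun z => 1 - Polynomial.C z * Polynomial.X).prod := by
  have hP := (IsAlgClosed.splits P).eq_prod_roots
  refine ⟨P.roots.map (·⁻¹), by simpa using P.card_roots', ?_⟩
  have hne : ∀ r ∈ P.roots, r ≠ 0 := by
    rintro r hr rfl
    have := Polynomial.isRoot_of_mem_roots hr
    rw [Polynomial.IsRoot, ← Polynomial.coeff_zero_eq_eval_zero, h0] at this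
    exact one_ne_zero this
  have hfac : (P.roots.map fun r => Polynomial.X - Polynomial.C r).prod =
      Polynomial.C ((P.roots.map fun r => -r).prod) *
        ((P.roots.map (·⁻¹)).map fun z => 1 - Polynomial.C z * Polynomial.X).prod := by
    rw [Multiset.map_map, map_multiset_prod Polynomial.C, Multiset.map_map,
      ← Multiset.prod_map_mul]
    refine congrArg _ (Multiset.map_congr rfl fun r hr => ?_)
    have h1 : Polynomial.C r * Polynomial.C r⁻¹ = (1 : Polynomial ℂ) := by
      rw [← Polynomial.C_mul, mul_inv_cancel₀ (hne r hr), Polynomial.C_1]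
    simp only [Function.comp_apply, map_neg]
    linear_combination (-Polynomial.X) * h1
  rw [hfac, ← mul_assoc, ← Polynomial.C_mul] at hP
  set Q := ((P.roots.map (·⁻¹)).map fun z => 1 - Polynomial.C z * Polynomial.X).prod with hQ
  have hQ0 : Q.coeff 0 = 1 := by
    rw [Polynomial.coeff_zero_eq_eval_zero, hQ, Polynomial.eval_multiset_prod]
    refine Multiset.prod_eq_one fun x hx => ?_
    simp only [Multiset.map_map, Multiset.mem_map, Function.comp_apply] at hx
    obtain ⟨r, -, rfl⟩ := hx
    simp
  have hc := congrArg (Polynomial.coeff · 0) hP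
  simp only [Polynomial.coeff_C_mul, h0, hQ0, mul_one] at hc
  rw [hP, ← hc]
  simp

theorem PowerSeries.X_mul_derivative_prod_one_sub {R : Type*} [CommRing R] (s : Multiset R) :
    PowerSeries.X * PowerSeries.derivative R
        (s.map fun z => 1 - PowerSeries.C z * PowerSeries.X).prod =
      -(PowerSeries.mk fun k => if k = 0 then 0 else (s.map (· ^ k)).sum) *
        (s.map fun z => 1 - PowerSeries.C z * PowerSeries.X).prod := by
  induction s using Multiset.induction_on with
  | empty =>
    have : (PowerSeries.mk fun k => if k = 0 then (0 : R) else
        ((0 : Multiset R).map (· ^ k)).sum) = 0 := by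
      ext; simp
    rw [this]
    simp
  | cons z s ih =>
    set Q := (s.map fun z => 1 - PowerSeries.C z * PowerSeries.X).prod
    have hsplit : (PowerSeries.mk fun k => if k = 0 then (0 : R) else
        ((z ::ₘ s).map (· ^ k)).sum) =
        (PowerSeries.mk fun k => if k = 0 then (0 : R) else z ^ k) +
        (PowerSeries.mk fun k => if k = 0 then (0 : R) else (s.map (· ^ k)).sum) := by
      ext k
      by_cases hk : k = 0 <;> simp [hk]
    have hgeom : (PowerSeries.mk fun k => if k = 0 then (0 : R) else z ^ k) *
        (1 - PowerSeries.C z * PowerSeries.X) = PowerSeries.C z * PowerSeries.X := by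
      ext k
      rw [mul_sub, mul_one, mul_left_comm, map_sub, PowerSeries.coeff_C_mul,
        PowerSeries.coeff_C_mul, PowerSeries.coeff_mk]
      rcases k with _ | _ | k
      · simp
      · rw [PowerSeries.coeff_succ_mul_X, PowerSeries.coeff_mk]; simp
      · rw [PowerSeries.coeff_succ_mul_X, PowerSeries.coeff_mk, PowerSeries.coeff_X]; simp
        ring
    rw [Multiset.map_cons, Multiset.prod_cons, hsplit, Derivation.leibniz, map_sub,
      Derivation.leibniz, PowerSeries.derivative_X, PowerSeries.derivative_C,
      Derivation.map_one_eq_zero]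
    simp only [smul_eq_mul]
    linear_combination (1 - PowerSeries.C z * PowerSeries.X) * ih + Q * hgeom

theorem norm_le_of_newton_identities {m : ℕ} {b T : ℕ → ℂ} {C q : ℝ} (hm : 0 < m)
    (hb0 : b 0 = 1) (hb : ∀ n, m ≤ n → b n = 0)
    (hT : ∀ n, n * b n = ∑ x ∈ antidiagonal n, T x.1 * b x.2) (hq : 0 < q)
    (hC : ∀ k, 0 < k → ‖T (2 * k)‖ ≤ C * q ^ k) : ‖T 1‖ ≤ (m - 1) * √q := by
  classical
  set P : Polynomial ℂ := ∑ i ∈ range m, Polynomial.monomial i (b i) with hP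
  have hcoeff : ∀ n, P.coeff n = b n := by
    intro n
    simp only [hP, Polynomial.finsetSum_coeff, Polynomial.coeff_monomial]
    rw [sum_ite_eq' (range m)]
    split_ifs with h
    · rfl
    · exact (hb n (by simpa using h)).symm
  have hdeg : P.natDegree ≤ m - 1 := by
    rw [Polynomial.natDegree_le_iff_coeff_eq_zero]
    intro n hn
    rw [hcoeff, hb n (by omega)]
  obtain ⟨s, hs, hPs⟩ := Polynomial.exists_eq_prod_one_sub_mul_X (P := P) (by rw [hcoeff, hb0])
  have hPs' : (P : PowerSeries ℂ) =
      (s.map fun z => 1 - PowerSeries.C z * PowerSeries.X).prod := by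
    rw [hPs, ← Polynomial.coeToPowerSeries.ringHom_apply, map_multiset_prod, Multiset.map_map]
    refine congrArg _ (Multiset.map_congr rfl fun z _ => ?_)
    simp
  have h1 := PowerSeries.X_mul_derivative_prod_one_sub s
  rw [← hPs'] at h1
  have h2 : PowerSeries.X * PowerSeries.derivative ℂ (P : PowerSeries ℂ) =
      PowerSeries.mk T * (P : PowerSeries ℂ) := by
    ext n
    rw [PowerSeries.coeff_mul n (PowerSeries.mk T)]
    simp only [PowerSeries.coeff_mk, Polynomial.coeff_coe, hcoeff]
    rw [← hT]
    rcases n with _ | n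
    · simp
    · rw [PowerSeries.coeff_succ_X_mul, PowerSeries.coeff_derivative, Polynomial.coeff_coe, hcoeff]
      push_cast
      ring
  have hP0 : (P : PowerSeries ℂ) ≠ 0 := by
    intro h
    have := congrArg (PowerSeries.coeff 0) h
    rw [Polynomial.coeff_coe, hcoeff, hb0] at this
    simp at this
  have h3 := mul_right_cancel₀ hP0 (h2.symm.trans h1)
  have hTs : ∀ k, 0 < k → T k = -(s.map (· ^ k)).sum := by
    intro k hk
    have := congrArg (PowerSeries.coeff k) h3
    simpa [hk.ne'] using this
  have hsq : ∀ z ∈ s, ‖z‖ ≤ √q := by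
    intro z hz
    refine Real.le_sqrt_of_sq_le ?_
    rw [← norm_pow]
    refine norm_le_of_forall_norm_sum_pow_le (s := s.map (· ^ 2)) (C := C) hq (fun k hk => ?_)
      (Multiset.mem_map_of_mem _ hz)
    have h4 := hC k hk
    rw [hTs _ (by omega), norm_neg] at h4
    rw [Multiset.map_map]
    simpa [Function.comp_def, ← pow_mul] using h4
  rw [hTs 1 one_pos, norm_neg]
  simp only [pow_one, Multiset.map_id']
  calc ‖s.sum‖ ≤ (s.map fun z => ‖z‖).sum := norm_multiset_sum_le s
    _ ≤ (s.map fun _ => √q).sum := Multiset.sum_map_le_sum_map _ _ hsq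
    _ = s.card * √q := by simp
    _ ≤ (m - 1) * √q := by
      have h5 : s.card + 1 ≤ m := by omega
      have h6 : (s.card : ℝ) + 1 ≤ m := by exact_mod_cast h5
      gcongr
      linarith

theorem Polynomial.finite_setOf_monic_natDegree_eq (R : Type*) [CommRing R] [Finite R] (n : ℕ) :
    {g : Polynomial R | g.Monic ∧ g.natDegree = n}.Finite := by
  refine Set.Finite.of_finite_image (f := fun (g : Polynomial R) (i : Fin (n + 1)) => g.coeff i)
    (Set.toFinite _) ?_
  rintro g ⟨-, hg⟩ h ⟨-, hh⟩ hgh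
  ext i
  by_cases hi : i < n + 1
  · exact congrFun hgh ⟨i, hi⟩
  · rw [Polynomial.coeff_eq_zero_of_natDegree_lt (by omega),
      Polynomial.coeff_eq_zero_of_natDegree_lt (by omega)]

/-- The monic polynomials of degree `n` over a finite ring. -/
noncomputable def monicsOfDegree (R : Type*) [CommRing R] [Finite R] (n : ℕ) :
    Finset (Polynomial R) :=
  (Polynomial.finite_setOf_monic_natDegree_eq R n).toFinset

theorem mem_monicsOfDegree {R : Type*} [CommRing R] [Finite R] {n : ℕ} {g : Polynomial R} :
    g ∈ monicsOfDegree R n ↔ g.Monic ∧ g.natDegree = n := by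
  simp [monicsOfDegree]

/-- The monic irreducible polynomials of degree `n` over a finite ring. -/
noncomputable def monicIrreduciblesOfDegree (R : Type*) [CommRing R] [Finite R] (n : ℕ) :
    Finset (Polynomial R) :=
  by classical exact (monicsOfDegree R n).filter Irreducible

theorem mem_monicIrreduciblesOfDegree {R : Type*} [CommRing R] [Finite R] {n : ℕ}
    {g : Polynomial R} :
    g ∈ monicIrreduciblesOfDegree R n ↔ (g.Monic ∧ g.natDegree = n) ∧ Irreducible g := by
  simp [monicIrreduciblesOfDegree, mem_monicsOfDegree]

theorem Polynomial.natDegree_eq_sum_monicIrreduciblesOfDegree {F : Type*} [Field F] [Finite F]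
    [DecidableEq F] {g : Polynomial F} (hg : g.Monic) :
    g.natDegree = ∑ d ∈ Icc 1 g.natDegree, ∑ P ∈ monicIrreduciblesOfDegree F d,
      d * (UniqueFactorizationMonoid.normalizedFactors g).count P := by
  classical
  have hg0 := hg.ne_zero
  have hprod : (UniqueFactorizationMonoid.normalizedFactors g).prod = g := by
    have := UniqueFactorizationMonoid.prod_normalizedFactors_eq hg0
    rwa [hg.normalize_eq_self] at this
  set s := UniqueFactorizationMonoid.normalizedFactors g with hs
  have hmem : ∀ P ∈ s, (P.Monic ∧ 1 ≤ P.natDegree) ∧ Irreducible P ∧ P ∣ g := by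
    intro P hP
    have hirr := UniqueFactorizationMonoid.irreducible_of_normalized_factor P hP
    have hn := UniqueFactorizationMonoid.normalize_normalized_factor P hP
    refine ⟨⟨?_, hirr.natDegree_pos⟩, hirr,
      UniqueFactorizationMonoid.dvd_of_mem_normalizedFactors hP⟩
    rw [← hn]
    exact Polynomial.monic_normalize hirr.ne_zero
  have h1 : g.natDegree = ∑ P ∈ s.toFinset, P.natDegree * s.count P := by
    conv_lhs => rw [← hprod]
    rw [Polynomial.natDegree_multiset_prod_of_monic _ fun P hP => (hmem P hP).1.1,
      Finset.sum_multiset_map_count]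
    exact sum_congr rfl fun P _ => by rw [smul_eq_mul, mul_comm]
  have h2 : ∀ P ∈ s.toFinset, P.natDegree ∈ Icc 1 g.natDegree := fun P hP => by
    have := hmem P (Multiset.mem_toFinset.mp hP)
    exact mem_Icc.mpr ⟨this.1.2, Polynomial.natDegree_le_of_dvd this.2.2 hg0⟩
  refine h1.trans ((sum_fiberwise_of_maps_to h2 _).symm.trans ?_)
  refine sum_congr rfl fun d _ => ?_
  refine sum_subset_zero_on_sdiff (fun P hP => ?_) (fun P hP => ?_) (fun P hP => ?_)
  · rw [mem_filter, Multiset.mem_toFinset] at hP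
    have := hmem P hP.1
    exact mem_monicIrreduciblesOfDegree.mpr ⟨⟨this.1.1, hP.2⟩, this.2.1⟩
  · rw [mem_sdiff, mem_filter, Multiset.mem_toFinset, mem_monicIrreduciblesOfDegree] at hP
    rw [Multiset.count_eq_zero_of_notMem fun h => hP.2 ⟨h, hP.1.1.2⟩, mul_zero]
  · rw [(mem_filter.mp hP).2]

theorem card_filter_pow_dvd {F : Type*} [Field F] [DecidableEq F] {g P : Polynomial F}
    (hg : g ≠ 0) (hP : Irreducible P) (hPm : P.Monic) [DecidablePred (P ^ · ∣ g)] {s : Finset ℕ}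
    (hs : ∀ j, j ∈ s ↔ 1 ≤ j ∧ P.natDegree * j ≤ g.natDegree) :
    #{j ∈ s | P ^ j ∣ g} = (UniqueFactorizationMonoid.normalizedFactors g).count P := by
  classical
  have key : ∀ j, P ^ j ∣ g ↔ j ≤ (UniqueFactorizationMonoid.normalizedFactors g).count P := by
    intro j
    rw [pow_dvd_iff_le_emultiplicity,
      UniqueFactorizationMonoid.emultiplicity_eq_count_normalizedFactors hP hg,
      hPm.normalize_eq_self, Nat.cast_le]
  have : {j ∈ s | P ^ j ∣ g} = Icc 1 ((UniqueFactorizationMonoid.normalizedFactors g).count P) := by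
    ext j
    rw [mem_filter, hs, mem_Icc, key]
    refine ⟨fun h => ⟨h.1.1, h.2⟩, fun h => ⟨⟨h.1, ?_⟩, h.2⟩⟩
    have := Polynomial.natDegree_le_of_dvd ((key j).mpr h.2) hg
    rwa [Polynomial.natDegree_pow, mul_comm] at this
  rw [this, Nat.card_Icc, Nat.add_sub_cancel]

/-- The sum of `Λ` over the monic polynomials of degree `n`. -/
noncomputable def monicSum {R : Type*} [CommRing R] [Finite R] (Λ : Polynomial R →* ℂ) (n : ℕ) :
    ℂ :=
  ∑ g ∈ monicsOfDegree R n, Λ g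

/-- The sum of `Λ`, weighted by the von Mangoldt function, over the monic prime powers of
degree `k`. -/
noncomputable def primePowerSum {R : Type*} [CommRing R] [Finite R] (Λ : Polynomial R →* ℂ)
    (k : ℕ) : ℂ :=
  ∑ x ∈ k.divisorsAntidiagonal, ∑ P ∈ monicIrreduciblesOfDegree R x.1, x.1 * Λ P ^ x.2

theorem primePowerSum_mul_monicSum {F : Type*} [Field F] [Finite F] (Λ : Polynomial F →* ℂ)
    {k n : ℕ} (hkn : k ≤ n) :
    primePowerSum Λ k * monicSum Λ (n - k) = ∑ g ∈ monicsOfDegree F n, Λ g *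
      ∑ x ∈ k.divisorsAntidiagonal, ∑ P ∈ monicIrreduciblesOfDegree F x.1,
        by classical exact if P ^ x.2 ∣ g then (x.1 : ℂ) else 0 := by
  classical
  rw [primePowerSum, sum_mul]
  simp_rw [sum_mul, mul_sum]
  rw [sum_comm]
  refine sum_congr rfl fun x hx => ?_
  rw [sum_comm]
  refine sum_congr rfl fun P hP => ?_
  rw [mem_monicIrreduciblesOfDegree] at hP
  rw [Nat.mem_divisorsAntidiagonal] at hx
  simp_rw [mul_ite, mul_zero]
  rw [← sum_filter, monicSum, mul_sum]
  have hPm : (P ^ x.2).Monic := hP.1.1.pow _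
  have hPd : (P ^ x.2).natDegree = k := by
    rw [hP.1.1.natDegree_pow, hP.1.2, mul_comm, hx.1]
  refine sum_bij (fun h _ => P ^ x.2 * h) (fun h hh => ?_) (fun h₁ _ h₂ _ e => ?_)
    (fun g hg => ?_) (fun h hh => ?_)
  · rw [mem_monicsOfDegree] at hh
    rw [mem_filter, mem_monicsOfDegree, hPm.natDegree_mul hh.1, hPd, hh.2]
    exact ⟨⟨hPm.mul hh.1, by omega⟩, dvd_mul_right _ _⟩
  · exact mul_left_cancel₀ hPm.ne_zero e
  · rw [mem_filter, mem_monicsOfDegree] at hg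
    obtain ⟨⟨hgm, hgd⟩, h, rfl⟩ := hg
    have hhm := hPm.of_mul_monic_left hgm
    rw [hPm.natDegree_mul hhm, hPd] at hgd
    exact ⟨h, mem_monicsOfDegree.mpr ⟨hhm, by omega⟩, rfl⟩
  · rw [map_mul, map_pow]
    ring

theorem natCast_mul_monicSum {F : Type*} [Field F] [Finite F] (Λ : Polynomial F →* ℂ) (n : ℕ) :
    n * monicSum Λ n = ∑ x ∈ antidiagonal n, primePowerSum Λ x.1 * monicSum Λ x.2 := by
  classical
  rw [Finset.Nat.sum_antidiagonal_eq_sum_range_succ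
    (fun i j => primePowerSum Λ i * monicSum Λ j)]
  rw [sum_congr rfl fun k hk => primePowerSum_mul_monicSum Λ (mem_range_succ_iff.mp hk), sum_comm,
    monicSum, mul_sum]
  refine sum_congr rfl fun g hg => ?_
  rw [← mul_sum, mul_comm]
  congr 1
  rw [mem_monicsOfDegree] at hg
  have h1 := Polynomial.natDegree_eq_sum_monicIrreduciblesOfDegree hg.1
  rw [hg.2] at h1
  conv_lhs => rw [h1]
  push_cast
  have h2 : ∀ d ∈ Icc 1 n, ∀ P ∈ monicIrreduciblesOfDegree F d,
      (d : ℂ) * (UniqueFactorizationMonoid.normalizedFactors g).count P =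
        ∑ j ∈ Icc 1 n with d * j ≤ n, if P ^ j ∣ g then (d : ℂ) else 0 := by
    intro d hd P hP
    rw [mem_Icc] at hd
    rw [mem_monicIrreduciblesOfDegree] at hP
    rw [← card_filter_pow_dvd hg.1.ne_zero hP.2 hP.1.1
      (s := {j ∈ Icc 1 n | d * j ≤ n}), ← sum_filter, sum_const, nsmul_eq_mul, mul_comm]
    intro j
    rw [mem_filter, mem_Icc, hP.1.2, hg.2]
    refine ⟨fun h => ⟨h.1.1, h.2⟩, fun h => ⟨⟨h.1, ?_⟩, h.2⟩⟩
    nlinarith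
  rw [sum_congr rfl fun d hd => sum_congr rfl (h2 d hd)]
  rw [sum_congr rfl fun d _ => sum_comm]
  rw [sum_sigma' (Icc 1 n) (fun d => {j ∈ Icc 1 n | d * j ≤ n}),
    sum_sigma' (range (n + 1)) (fun k => k.divisorsAntidiagonal)]
  refine sum_bij' (fun x _ => ⟨x.1 * x.2, (x.1, x.2)⟩) (fun x _ => ⟨x.2.1, x.2.2⟩) ?_ ?_ ?_ ?_ ?_
  · rintro ⟨d, j⟩ h
    simp only [mem_sigma, mem_filter, mem_Icc] at h
    simp only [mem_sigma, mem_range, Nat.mem_divisorsAntidiagonal]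
    have : 0 < d * j := Nat.mul_pos (by omega) (by omega)
    exact ⟨by omega, trivial, by omega⟩
  · rintro ⟨k, d, j⟩ h
    simp only [mem_sigma, mem_range, Nat.mem_divisorsAntidiagonal] at h
    simp only [mem_sigma, mem_filter, mem_Icc]
    obtain ⟨h1, rfl, h3⟩ := h
    have hd : 0 < d := Nat.pos_of_mul_pos_right (Nat.pos_of_ne_zero h3)
    have hj : 0 < j := Nat.pos_of_mul_pos_left (Nat.pos_of_ne_zero h3)
    refine ⟨⟨hd, ?_⟩, ⟨hj, ?_⟩, ?_⟩ <;> nlinarith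
  · rintro ⟨d, j⟩ h
    rfl
  · rintro ⟨k, d, j⟩ h
    simp only [mem_sigma, mem_range, Nat.mem_divisorsAntidiagonal] at h
    obtain ⟨h1, rfl, h3⟩ := h
    rfl
  · rintro ⟨d, j⟩ h
    rfl

/-- The completely multiplicative function `g ↦ ∏ c ∈ T, χ c (g c)` on polynomials. -/
noncomputable def evalMulChar {F : Type*} [CommRing F] (T : Finset F) (χ : F → MulChar F ℂ) :
    Polynomial F →* ℂ where
  toFun g := ∏ c ∈ T, χ c (g.eval c)
  map_one' := by simp
  map_mul' g h := by simp [prod_mul_distrib]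

theorem evalMulChar_apply {F : Type*} [CommRing F] (T : Finset F) (χ : F → MulChar F ℂ)
    (g : Polynomial F) : evalMulChar T χ g = ∏ c ∈ T, χ c (g.eval c) := rfl

theorem monicSum_evalMulChar_eq_zero {F : Type*} [Field F] [Fintype F] [DecidableEq F]
    {T : Finset F} {χ : F → MulChar F ℂ} {c₀ : F} (hc₀ : c₀ ∈ T) (hχ : χ c₀ ≠ 1) {n : ℕ}
    (hn : #T ≤ n) : monicSum (evalMulChar T χ) n = 0 := by
  set h : Polynomial F := ∏ c ∈ T.erase c₀, (Polynomial.X - Polynomial.C c) with hh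
  have hdeg : h.natDegree < n := by
    rw [hh, Polynomial.natDegree_finsetProd_X_sub_C_eq_card, card_erase_of_mem hc₀]
    have := card_pos.mpr ⟨c₀, hc₀⟩
    omega
  have hroot : ∀ c ∈ T.erase c₀, h.eval c = 0 := fun c hc => by
    rw [hh, Polynomial.eval_prod, prod_eq_zero hc (by simp)]
  have hne : h.eval c₀ ≠ 0 := by
    rw [hh, Polynomial.eval_prod, prod_ne_zero_iff]
    intro c hc
    simpa [sub_eq_zero] using (ne_of_mem_erase hc).symm
  have hmem : ∀ t : F, ∀ g ∈ monicsOfDegree F n, g + Polynomial.C t * h ∈ monicsOfDegree F n := by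
    intro t g hg
    rw [mem_monicsOfDegree] at hg ⊢
    have hlt : (Polynomial.C t * h).degree < g.degree := by
      rw [Polynomial.degree_eq_natDegree hg.1.ne_zero, hg.2]
      refine (Polynomial.degree_le_natDegree).trans_lt ?_
      exact_mod_cast (Polynomial.natDegree_C_mul_le t h).trans_lt hdeg
    exact ⟨hg.1.add_of_left hlt, by rw [Polynomial.natDegree_add_eq_left_of_degree_lt hlt, hg.2]⟩
  have htrans : ∀ t : F, monicSum (evalMulChar T χ) n =
      ∑ g ∈ monicsOfDegree F n, evalMulChar T χ (g + Polynomial.C t * h) := by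
    intro t
    refine sum_bij' (fun g _ => g + Polynomial.C (-t) * h) (fun g _ => g + Polynomial.C t * h)
      (fun g hg => hmem _ g hg) (fun g hg => hmem _ g hg) ?_ ?_ ?_ <;> intro g _
    · simp
    · simp
    · congr 1
      simp
  have hzero : ∑ t : F, monicSum (evalMulChar T χ) n = 0 := by
    rw [sum_congr rfl fun t _ => htrans t, sum_comm]
    refine sum_eq_zero fun g _ => ?_
    have hev : ∀ t : F, evalMulChar T χ (g + Polynomial.C t * h) =
        χ c₀ (g.eval c₀ + t * h.eval c₀) * ∏ c ∈ T.erase c₀, χ c (g.eval c) := by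
      intro t
      rw [evalMulChar_apply, ← mul_prod_erase T _ hc₀]
      congr 1
      · simp
      · refine prod_congr rfl fun c hc => ?_
        simp [hroot c hc]
    simp_rw [hev]
    rw [← sum_mul]
    have hbij : ∑ t : F, χ c₀ (g.eval c₀ + t * h.eval c₀) = ∑ t : F, χ c₀ t :=
      Fintype.sum_equiv ((Equiv.mulRight₀ _ hne).trans (Equiv.addLeft (g.eval c₀))) _ _
        fun t => by simp
    rw [hbij, MulChar.sum_eq_zero_of_ne_one hχ, zero_mul]
  rw [sum_const, nsmul_eq_mul, mul_eq_zero] at hzero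
  refine hzero.resolve_left ?_
  rw [Nat.cast_eq_zero, card_univ]
  exact Fintype.card_ne_zero

theorem monicSum_zero {F : Type*} [Field F] [Finite F] (Λ : Polynomial F →* ℂ) :
    monicSum Λ 0 = 1 := by
  have : monicsOfDegree F 0 = {1} := by
    ext g
    rw [mem_monicsOfDegree, mem_singleton]
    exact ⟨fun h => h.1.natDegree_eq_zero.mp h.2, fun h => by simp [h]⟩
  rw [monicSum, this, sum_singleton, map_one]

theorem Algebra.norm_algebraMap_sub_eq_eval_minpoly_pow {F K : Type*} [Field F] [Field K]
    [Algebra F K] [FiniteDimensional F K] (x : K) (c : F) :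
    Algebra.norm F (algebraMap F K c - x) =
      (minpoly F x).eval c ^ (Module.finrank F K / (minpoly F x).natDegree) := by
  set z := x - algebraMap F K c with hz
  have hzint : IsIntegral F z := Algebra.IsIntegral.isIntegral z
  have hmin : minpoly F z = (minpoly F x).comp (Polynomial.X + Polynomial.C c) :=
    minpoly.sub_algebraMap x c
  have hdeg : (minpoly F z).natDegree = (minpoly F x).natDegree := by
    rw [hmin, Polynomial.natDegree_comp, Polynomial.natDegree_X_add_C, mul_one]
  have hfin : (minpoly F x).natDegree * Module.finrank (IntermediateField.adjoin F {z}) K =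
      Module.finrank F K := by
    rw [← hdeg, ← IntermediateField.adjoin.finrank hzint, Module.finrank_mul_finrank]
  have hpos : 0 < (minpoly F x).natDegree :=
    minpoly.natDegree_pos (Algebra.IsIntegral.isIntegral x)
  have hgen : Algebra.norm F (IntermediateField.AdjoinSimple.gen F z) =
      (-1) ^ (minpoly F x).natDegree * (minpoly F x).eval c := by
    have h1 := PowerBasis.norm_gen_eq_coeff_zero_minpoly (IntermediateField.adjoin.powerBasis hzint)
    rw [IntermediateField.adjoin.powerBasis_gen, IntermediateField.minpoly_gen,
      IntermediateField.adjoin.powerBasis_dim, hdeg, hmin,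
      Polynomial.coeff_zero_eq_eval_zero, Polynomial.eval_comp] at h1
    simpa using h1
  have hneg : algebraMap F K c - x = algebraMap F K (-1) * z := by
    rw [hz, map_neg, map_one]; ring
  rw [hneg, map_mul, Algebra.norm_algebraMap, Algebra.norm_eq_norm_adjoin, hgen, ← hfin,
    Nat.mul_div_cancel_left _ hpos, mul_pow, ← mul_assoc, pow_mul, ← mul_pow, ← mul_pow]
  simp [← mul_pow]

theorem FiniteField.card_filter_minpoly_eq {F K : Type*} [Field F] [Finite F] [Field K]
    [Fintype K] [Algebra F K] [DecidableEq (Polynomial F)] {P : Polynomial F} (hP : Irreducible P)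
    (hPm : P.Monic) (hPd : P.natDegree ∣ Module.finrank F K) :
    #{x : K | minpoly F x = P} = P.natDegree := by
  classical
  have hdvd : P ∣ Polynomial.X ^ Fintype.card K - Polynomial.X := by
    rw [Fintype.card_eq_nat_card, Module.natCard_eq_pow_finrank (K := F)]
    exact hP.natDegree_dvd_iff_dvd_X_pow_card_pow_sub_X.mp hPd
  have hX := FiniteField.X_pow_card_sub_X_ne_zero K (Fintype.one_lt_card (α := K))
  have hXs : (Polynomial.X ^ Fintype.card K - Polynomial.X : Polynomial K).Splits := by
    rw [Polynomial.splits_iff_card_roots, FiniteField.roots_X_pow_card_sub_X,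
      FiniteField.X_pow_card_sub_X_natDegree_eq K Fintype.one_lt_card]
    rfl
  have hsplits : (P.map (algebraMap F K)).Splits :=
    hXs.of_dvd hX (by simpa using Polynomial.map_dvd (algebraMap F K) hdvd)
  have hroots : ({x : K | minpoly F x = P} : Finset K) =
      (P.map (algebraMap F K)).roots.toFinset := by
    ext x
    rw [mem_filter, Multiset.mem_toFinset,
      Polynomial.mem_roots (Polynomial.map_ne_zero hP.ne_zero), Polynomial.IsRoot,
      Polynomial.eval_map_algebraMap]
    refine ⟨fun h => by rw [← h.2, minpoly.aeval], fun h => ⟨mem_univ _, ?_⟩⟩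
    exact (minpoly.eq_of_irreducible_of_monic hP h hPm).symm
  rw [hroots, Multiset.toFinset_card_of_nodup
    (Polynomial.nodup_roots (PerfectField.separable_of_irreducible hP).map),
    ← hsplits.natDegree_eq_card_roots, Polynomial.natDegree_map]

theorem primePowerSum_eq_sum_minpoly {F K : Type*} [Field F] [Finite F] [Field K]
    [Fintype K] [Algebra F K] (Λ : Polynomial F →* ℂ) :
    primePowerSum Λ (Module.finrank F K) =
      ∑ x : K, Λ (minpoly F x) ^ (Module.finrank F K / (minpoly F x).natDegree) := by
  classical
  set k := Module.finrank F K with hk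
  have hk0 : 0 < k := Module.finrank_pos
  have hdvd : ∀ x : K, (minpoly F x).natDegree ∣ k := fun x => by
    rw [← IntermediateField.adjoin.finrank (Algebra.IsIntegral.isIntegral x)]
    exact ⟨_, (Module.finrank_mul_finrank F _ K).symm⟩
  have hmaps : ∀ x ∈ (univ : Finset K), ((minpoly F x).natDegree,
      k / (minpoly F x).natDegree) ∈ k.divisorsAntidiagonal := fun x _ => by
    rw [Nat.mem_divisorsAntidiagonal]
    exact ⟨Nat.mul_div_cancel' (hdvd x), hk0.ne'⟩
  rw [primePowerSum, ← sum_fiberwise_of_maps_to hmaps]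
  refine sum_congr rfl fun y hy => ?_
  rw [Nat.mem_divisorsAntidiagonal] at hy
  have hy0 : 0 < y.1 := Nat.pos_of_ne_zero fun h => by simp [h] at hy; omega
  have hfil : ∀ x : K, ((minpoly F x).natDegree, k / (minpoly F x).natDegree) = y ↔
      (minpoly F x).natDegree = y.1 := fun x => by
    refine ⟨fun h => by rw [← h], fun h => ?_⟩
    rw [h, ← hy.1, Nat.mul_div_cancel_left _ hy0]
  have hmaps2 : ∀ x ∈ ({x : K | ((minpoly F x).natDegree, k / (minpoly F x).natDegree) = y} :
      Finset K), minpoly F x ∈ monicIrreduciblesOfDegree F y.1 := fun x hx => by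
    have hx_int : IsIntegral F x := Algebra.IsIntegral.isIntegral x
    rw [mem_filter, hfil] at hx
    exact mem_monicIrreduciblesOfDegree.mpr ⟨⟨minpoly.monic hx_int, hx.2⟩, minpoly.irreducible hx_int⟩
  rw [← sum_fiberwise_of_maps_to hmaps2]
  refine sum_congr rfl fun P hP => ?_
  rw [mem_monicIrreduciblesOfDegree] at hP
  have hset : (({x : K | ((minpoly F x).natDegree, k / (minpoly F x).natDegree) = y} :
      Finset K).filter fun x => minpoly F x = P) = univ.filter fun x : K => minpoly F x = P := by
    ext x
    simp only [mem_filter, mem_univ, true_and, hfil]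
    exact ⟨fun h => h.2, fun h => ⟨by rw [h, hP.1.2], h⟩⟩
  rw [hset, sum_congr rfl (g := fun _ => Λ P ^ y.2), sum_const, nsmul_eq_mul,
    FiniteField.card_filter_minpoly_eq hP.2 hP.1.1, hP.1.2]
  · rw [hP.1.2, ← hk, ← hy.1]; exact dvd_mul_right _ _
  · intro x hx
    rw [(mem_filter.mp hx).2, hP.1.2, ← hy.1, Nat.mul_div_cancel_left _ hy0]

theorem primePowerSum_evalMulChar {F K : Type*} [Field F] [Finite F] [Field K]
    [Fintype K] [Algebra F K] (T : Finset F) (χ : F → MulChar F ℂ) :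
    primePowerSum (evalMulChar T χ) (Module.finrank F K) =
      ∑ x : K, ∏ c ∈ T, χ c (Algebra.norm F (algebraMap F K c - x)) := by
  rw [primePowerSum_eq_sum_minpoly]
  refine sum_congr rfl fun x _ => ?_
  rw [evalMulChar_apply, ← prod_pow]
  refine prod_congr rfl fun c _ => ?_
  rw [Algebra.norm_algebraMap_sub_eq_eval_minpoly_pow, map_pow]

theorem exists_forall_norm_primePowerSum_le {F : Type*} [Field F] [Fintype F] {T : Finset F}
    {χ : F → MulChar F ℂ} (hT : T.Nonempty) (hχ : ∀ c ∈ T, χ c ≠ 1) :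
    ∃ C : ℝ, ∀ k, 0 < k →
      ‖primePowerSum (evalMulChar T χ) (2 * k)‖ ≤ C * (Fintype.card F : ℝ) ^ k := by
  classical
  have hcyc : IsCyclic (MulChar F ℂ) :=
    isCyclic_of_injective (MulChar.mulEquiv_units F ℂ).some.toMonoidHom
      (MulChar.mulEquiv_units F ℂ).some.injective
  set H : Subgroup (MulChar F ℂ) := Subgroup.closure (χ '' T) with hH
  obtain ⟨⟨χ', hχ'H⟩, hgen⟩ := IsCyclic.exists_monoid_generator (α := H)
  have hpow : ∀ c ∈ T, ∃ a : ℕ, χ' ^ a = χ c := by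
    intro c hc
    obtain ⟨a, ha⟩ := hgen ⟨χ c, Subgroup.subset_closure ⟨c, hc, rfl⟩⟩
    exact ⟨a, congrArg Subtype.val ha⟩
  choose! a ha using hpow
  have ha0 : ∀ c ∈ T, a c ≠ 0 := fun c hc h => hχ c hc (by rw [← ha c hc, h, pow_zero])
  have hχ'1 : χ' ≠ 1 := by
    rintro rfl
    obtain ⟨c, hc⟩ := hT
    exact hχ c hc (by rw [← ha c hc, one_pow])
  set d := orderOf χ' with hd
  set f : Polynomial F := ∏ c ∈ T, (Polynomial.C c - Polynomial.X) ^ a c with hf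
  have hroots : f.roots = ∑ c ∈ T, a c • {c} := by
    rw [hf, Polynomial.roots_prod]
    · simp_rw [Polynomial.roots_pow]
      refine sum_congr rfl fun c _ => ?_
      rw [← neg_sub, Polynomial.roots_neg, Polynomial.roots_X_sub_C]
    · rw [prod_ne_zero_iff]
      intro c _
      rw [← neg_sub]
      exact pow_ne_zero _ (neg_ne_zero.mpr (Polynomial.X_sub_C_ne_zero c))
  have hmult : ∀ c ∈ T, f.rootMultiplicity c = a c := by
    intro c hc
    rw [← Polynomial.count_roots, hroots, Multiset.count_sum', sum_eq_single c]
    · simp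
    · intro b _ hb
      simp [hb.symm]
    · exact fun h => absurd hc h
  refine ⟨(4 * (f.natDegree + 1) * (d + 1) ^ 2 + f.natDegree : ℕ), fun k hk => ?_⟩
  obtain ⟨p, _⟩ := CharP.exists F
  have : Fact p.Prime := ⟨CharP.char_is_prime F p⟩
  have : NeZero (2 * k) := ⟨by omega⟩
  let K := FiniteField.Extension F p (2 * k)
  have : Fintype K := Fintype.ofFinite K
  have hcard : Fintype.card K = (Fintype.card F ^ k) ^ 2 := by
    rw [Fintype.card_eq_nat_card, FiniteField.natCard_extension, Nat.card_eq_fintype_card]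
    ring
  rw [← FiniteField.finrank_extension F p (2 * k), primePowerSum_evalMulChar (K := K)]
  have hsum : ∀ x : K, ∏ c ∈ T, χ c (Algebra.norm F (algebraMap F K c - x)) =
      χ' (Algebra.norm F (Polynomial.aeval x f)) := by
    intro x
    rw [hf, map_prod, map_prod, map_prod]
    refine prod_congr rfl fun c hc => ?_
    rw [← ha c hc, MulChar.pow_apply' _ (ha0 c hc)]
    simp
  simp_rw [hsum]
  refine norm_sum_mulChar_norm_le (MulChar.orderOf_dvd_card_sub_one F χ')
    (pow_orderOf_eq_one χ') hχ'1 hcard fun j hj => ?_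
  rw [orderOf_dvd_iff_pow_eq_one]
  have hker : H ≤ (powMonoidHom j : MulChar F ℂ →* MulChar F ℂ).ker := by
    rw [hH, Subgroup.closure_le]
    rintro _ ⟨c, hc, rfl⟩
    rw [SetLike.mem_coe, MonoidHom.mem_ker, powMonoidHom_apply, ← ha c hc, ← pow_mul,
      ← orderOf_dvd_iff_pow_eq_one]
    have := hj (algebraMap F K c)
    rwa [← Polynomial.eq_rootMultiplicity_map (algebraMap F K).injective, hmult c hc,
      mul_comm] at this
  exact hker hχ'H

theorem norm_sum_prod_mulChar_sub_le {F : Type*} [Field F] [Fintype F] {T : Finset F}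
    {χ : F → MulChar F ℂ} (hT : T.Nonempty) (hχ : ∀ c ∈ T, χ c ≠ 1) :
    ‖∑ x : F, ∏ c ∈ T, χ c (c - x)‖ ≤ (#T - 1) * √(Fintype.card F) := by
  classical
  obtain ⟨C, hC⟩ := exists_forall_norm_primePowerSum_le hT hχ
  obtain ⟨c₀, hc₀⟩ := hT
  have h1 : ∑ x : F, ∏ c ∈ T, χ c (c - x) = primePowerSum (evalMulChar T χ) 1 := by
    have := primePowerSum_evalMulChar (K := F) T χ
    rw [Module.finrank_self] at this
    rw [this]
    simp
  rw [h1]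
  exact norm_le_of_newton_identities (card_pos.mpr ⟨c₀, hc₀⟩) (monicSum_zero _)
    (fun n hn => monicSum_evalMulChar_eq_zero hc₀ (hχ c₀ hc₀) hn)
    (natCast_mul_monicSum _) (by exact_mod_cast Fintype.card_pos) hC

theorem MulChar.norm_apply_le_one {F : Type*} [Field F] [Fintype F] (χ : MulChar F ℂ) (a : F) :
    ‖χ a‖ ≤ 1 := by
  by_cases ha : IsUnit a
  · obtain ⟨u, rfl⟩ := ha
    refine (Complex.norm_eq_one_of_pow_eq_one (n := Nat.card Fˣ) ?_ Nat.card_pos.ne').le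
    rw [← map_pow, ← Units.val_pow_eq_pow_val, pow_card_eq_one', Units.val_one, map_one]
  · rw [χ.map_nonunit ha, norm_zero]
    exact zero_le_one

theorem norm_sum_prod_mulChar_sub_le_of_exists_ne_one {F : Type*} [Field F] [Fintype F]
    {U : Finset F} {χ : F → MulChar F ℂ} (hχ : ∃ c ∈ U, χ c ≠ 1) :
    ‖∑ x : F, ∏ c ∈ U, χ c (c - x)‖ ≤ (#U - 1) * √(Fintype.card F) := by
  classical
  set T := {c ∈ U | χ c ≠ 1} with hT
  have hTne : T.Nonempty := by
    obtain ⟨c, hc, hc1⟩ := hχ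
    exact ⟨c, mem_filter.mpr ⟨hc, hc1⟩⟩
  have hTU : T ⊆ U := filter_subset _ _
  have hnorm : ∀ x : F, ‖∏ c ∈ T, χ c (c - x)‖ ≤ 1 := fun x => by
    rw [norm_prod]
    refine prod_le_one (fun _ _ => norm_nonneg _) fun c _ => ?_
    exact (χ c).norm_apply_le_one (c - x)
  have hx : ∀ x : F, ∏ c ∈ U, χ c (c - x) =
      ∏ c ∈ T, χ c (c - x) - if x ∈ U \ T then ∏ c ∈ T, χ c (c - x) else 0 := by
    intro x
    rw [← prod_sdiff hTU]
    have h1 : ∀ c ∈ U \ T, χ c = 1 := fun c hc => by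
      rw [mem_sdiff, hT, mem_filter, not_and, not_not] at hc
      exact hc.2 hc.1
    split_ifs with h
    · rw [prod_eq_zero h (by rw [sub_self, MulChar.map_zero]), zero_mul, sub_self]
    · rw [prod_eq_one, one_mul, sub_zero]
      intro c hc
      rw [h1 c hc]
      refine MulChar.one_apply (isUnit_iff_ne_zero.mpr (sub_ne_zero.mpr ?_))
      rintro rfl
      exact h hc
  simp_rw [hx]
  rw [sum_sub_distrib, ← sum_filter]
  have h2 := norm_sum_prod_mulChar_sub_le hTne fun c hc => (mem_filter.mp hc).2
  have h3 : ‖∑ x : F with x ∈ U \ T, ∏ c ∈ T, χ c (c - x)‖ ≤ #(U \ T) := by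
    refine (norm_sum_le_of_le _ fun x _ => hnorm x).trans ?_
    rw [sum_const, nsmul_one, filter_univ_mem]
  have h4 : (#U : ℝ) = #(U \ T) + #T := by
    exact_mod_cast (card_sdiff_add_card_eq_card hTU).symm
  have h5 : (1 : ℝ) ≤ √(Fintype.card F) :=
    Real.one_le_sqrt.mpr (by exact_mod_cast Fintype.card_pos)
  refine (norm_sub_le _ _).trans ((add_le_add h2 h3).trans ?_)
  rw [h4]
  have h6 : (#(U \ T) : ℝ) ≤ #(U \ T) * √(Fintype.card F) :=
    le_mul_of_one_le_right (Nat.cast_nonneg _) h5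
  linarith

theorem norm_sum_prod_mulChar_add_le {F ι : Type*} [Field F] [Fintype F] [Fintype ι]
    {c : ι → F} (hc : Function.Injective c) {χ : ι → MulChar F ℂ} (hχ : ∃ i, χ i ≠ 1) :
    ‖∑ g : F, ∏ i, χ i (g + c i)‖ ≤ (Fintype.card ι - 1) * √(Fintype.card F) := by
  classical
  obtain ⟨i, hi⟩ := hχ
  have h := norm_sum_prod_mulChar_sub_le_of_exists_ne_one (U := univ.image c)
    (χ := Function.extend c χ 1) ⟨c i, mem_image_of_mem _ (mem_univ _), by rwa [hc.extend_apply]⟩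
  rw [card_image_of_injective _ hc, card_univ] at h
  convert h using 2
  rw [← Equiv.sum_comp (Equiv.neg F)]
  refine sum_congr rfl fun x _ => ?_
  rw [prod_image hc.injOn]
  refine prod_congr rfl fun j _ => ?_
  rw [hc.extend_apply, Equiv.neg_apply, neg_add_eq_sub]

open Classical in
theorem exists_mulChar_expansion {F : Type*} [Field F] [Fintype F] {l : ℕ} (hl : l.Prime)
    (hlq : l ∣ Fintype.card F - 1) :
    ∃ ψ : MulChar F ℂ, orderOf ψ = l ∧ ∀ g : F, g ≠ 0 →
      ∑ i ∈ range l, (ψ ^ i) g = if ∃ h, g = h ^ l then (l : ℂ) else 0 := by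
  have : Fact l.Prime := ⟨hl⟩
  obtain ⟨ψ, hψ⟩ := MulChar.exists_mulChar_orderOf F hlq (Complex.isPrimitiveRoot_exp l hl.ne_zero)
  refine ⟨ψ, hψ, fun g hg => ?_⟩
  obtain ⟨u, rfl⟩ : ∃ u : Fˣ, (u : F) = g := ⟨Units.mk0 g hg, rfl⟩
  simp_rw [MulChar.pow_apply_coe]
  have hψl : ∀ v : Fˣ, ψ v ^ l = 1 := fun v => by
    rw [← MulChar.pow_apply_coe, ← hψ, pow_orderOf_eq_one, MulChar.one_apply_coe]
  split_ifs with h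
  · obtain ⟨y, hy⟩ := h
    have hy0 : IsUnit y := by
      rw [isUnit_iff_ne_zero]
      rintro rfl
      rw [zero_pow hl.ne_zero] at hy
      exact hg hy
    obtain ⟨v, rfl⟩ := hy0
    have : ψ u = 1 := by rw [hy, map_pow, hψl]
    simp [this]
  · have hne : ψ u ≠ 1 := by
      intro hu
      refine h ?_
      obtain ⟨γ, hγ⟩ := IsCyclic.exists_monoid_generator (α := Fˣ)
      obtain ⟨a, rfl⟩ := hγ u
      have hγ1 : ψ γ ≠ 1 := by
        intro h1
        have : ψ = 1 := MulChar.eq_one_iff.mpr fun v => by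
          obtain ⟨b, rfl⟩ := hγ v
          simp [h1]
        rw [this, orderOf_one] at hψ
        exact hl.one_lt.ne hψ
      have hord : orderOf (ψ γ) = l := orderOf_eq_prime (hψl γ) hγ1
      have : l ∣ a := by
        rw [← hord, orderOf_dvd_iff_pow_eq_one, ← hu]
        simp
      obtain ⟨b, rfl⟩ := this
      exact ⟨(γ : F) ^ b, by simp [← pow_mul, mul_comm]⟩
    have := mul_geom_sum (ψ u) l
    rw [hψl, sub_self] at this
    exact (mul_eq_zero.mp this).resolve_left (sub_ne_zero.mpr hne)

open Classical in
theorem exists_mulChar_expansion_forall_prime {F : Type*} [Field F] [Fintype F] (s : Finset ℕ)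
    (hs : ∀ l ∈ s, l.Prime ∧ l ∣ Fintype.card F - 1) :
    ∃ (ι : Type) (_ : Fintype ι) (χ : ι → MulChar F ℂ) (w : ι → ℂ) (i₀ : ι),
      χ i₀ = 1 ∧ w i₀ = 1 ∧ (∀ i, χ i = 1 → i = i₀) ∧ (∀ i, χ i ^ (∏ l ∈ s, l) = 1) ∧
      ∑ i, ‖w i‖ ≤ 2 ^ #s ∧ ∀ g : F, g ≠ 0 →
        (if ∀ l ∈ s, ¬∃ h, g = h ^ l then (1 : ℂ) else 0) =
          (∏ l ∈ s, (1 - 1 / (l : ℂ))) * ∑ i, w i * χ i g := by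
  induction s using Finset.induction_on with
  | empty =>
    refine ⟨Unit, inferInstance, 1, 1, (), rfl, rfl, fun _ _ => rfl, fun _ => one_pow _, by simp,
      fun g hg => ?_⟩
    simp [MulChar.one_apply (isUnit_iff_ne_zero.mpr hg)]
  | insert l s hls ih =>
    obtain ⟨hl, hlq⟩ := hs l (mem_insert_self _ _)
    have hs' := fun m hm => hs m (mem_insert_of_mem hm)
    obtain ⟨ι, _, χ, w, i₀, hχ, hw, huniq, hpow, hsum, hind⟩ := ih hs'
    obtain ⟨ψ, hψ, hexp⟩ := exists_mulChar_expansion hl hlq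
    have : NeZero l := ⟨hl.ne_zero⟩
    have hl1 : (1 : ℝ) < l := by exact_mod_cast hl.one_lt
    have hlR : (l : ℝ) - 1 ≠ 0 := by linarith
    have hlC : (l : ℂ) - 1 ≠ 0 := by exact_mod_cast hlR
    have hl0 : (l : ℂ) ≠ 0 := by exact_mod_cast hl.ne_zero
    set v : Fin l → ℂ := fun j => (if j = 0 then (l : ℂ) / (l - 1) else 0) - 1 / (l - 1) with hv
    have hψl : ψ ^ l = 1 := hψ ▸ pow_orderOf_eq_one ψ
    refine ⟨ι × Fin l, inferInstance, fun a => χ a.1 * ψ ^ (a.2 : ℕ), fun a => w a.1 * v a.2,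
      (i₀, 0), by simp [hχ], ?_, ?_, ?_, ?_, ?_⟩
    · simp only [hw, hv, if_true, one_mul]
      field_simp
    · rintro ⟨i, j⟩ hij
      dsimp only at hij
      have h1 : (ψ ^ (j : ℕ)) ^ (∏ m ∈ s, m) = 1 := by
        have := mul_pow (χ i) (ψ ^ (j : ℕ)) (∏ m ∈ s, m)
        rwa [hij, hpow, one_pow, one_mul, eq_comm] at this
      rw [← pow_mul, ← orderOf_dvd_iff_pow_eq_one, hψ] at h1
      have hcop : l.Coprime (∏ m ∈ s, m) := Nat.Coprime.prod_right fun m hm =>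
        (Nat.coprime_primes hl (hs' m hm).1).mpr fun h => hls (h ▸ hm)
      have hj : j = 0 := Fin.ext (Nat.eq_zero_of_dvd_of_lt (hcop.dvd_of_dvd_mul_right h1) j.2)
      subst hj
      simp only [Fin.val_zero, pow_zero, mul_one] at hij
      rw [huniq i hij]
    · rintro ⟨i, j⟩
      rw [prod_insert hls, mul_pow, mul_comm l, pow_mul, hpow, one_pow, one_mul, mul_comm _ l,
        pow_right_comm, pow_mul ψ, hψl, one_pow, one_pow]
    · have hvsum : ∑ j, ‖v j‖ = 2 := by
        rw [← add_sum_erase _ _ (mem_univ (0 : Fin l))]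
        have h0 : ‖v 0‖ = 1 := by
          have : v 0 = 1 := by
            simp only [hv, if_true]
            field_simp
          rw [this, norm_one]
        have h1 : ∀ j ∈ univ.erase (0 : Fin l), ‖v j‖ = 1 / ((l : ℝ) - 1) := fun j hj => by
          have : v j = -((1 / ((l : ℝ) - 1) : ℝ) : ℂ) := by
            simp [hv, (mem_erase.mp hj).1]
          rw [this, norm_neg, Complex.norm_real, Real.norm_of_nonneg]
          exact (one_div_pos.mpr (by linarith)).le
        rw [h0, sum_congr rfl h1, sum_const, card_erase_of_mem (mem_univ _), card_univ,
          Fintype.card_fin, nsmul_eq_mul, Nat.cast_sub hl.one_lt.le, Nat.cast_one,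
          mul_one_div_cancel hlR]
        norm_num
      simp_rw [norm_mul, Fintype.sum_prod_type, ← mul_sum, hvsum, ← sum_mul]
      rw [card_insert_of_notMem hls, pow_succ]
      gcongr
    · intro g hg
      have hψg : (if ¬∃ h, g = h ^ l then (1 : ℂ) else 0) =
          (1 - 1 / (l : ℂ)) * ∑ j, v j * (ψ ^ (j : ℕ)) g := by
        have h1 := hexp g hg
        rw [← Fin.sum_univ_eq_sum_range (fun i => (ψ ^ i) g)] at h1
        simp only [hv, sub_mul, sum_sub_distrib, ite_mul, zero_mul, sum_ite_eq', mem_univ,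
          if_true, ← mul_sum, h1, Fin.val_zero, pow_zero,
          MulChar.one_apply (isUnit_iff_ne_zero.mpr hg)]
        by_cases h2 : ∃ h, g = h ^ l
        · rw [if_neg (not_not.mpr h2), if_pos h2]
          field_simp
          ring
        · rw [if_pos h2, if_neg h2]
          field_simp
          ring
      have hsplit : (if ∀ m ∈ insert l s, ¬∃ h, g = h ^ m then (1 : ℂ) else 0) =
          (if ¬∃ h, g = h ^ l then (1 : ℂ) else 0) *
            if ∀ m ∈ s, ¬∃ h, g = h ^ m then (1 : ℂ) else 0 := by
        rw [ite_zero_mul_ite_zero, one_mul]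
        exact if_congr (forall_mem_insert _ _ _) rfl rfl
      rw [hsplit, hψg, hind g hg, prod_insert hls, mul_mul_mul_comm, sum_mul_sum, sum_comm,
        Fintype.sum_prod_type]
      congr 1
      refine sum_congr rfl fun i _ => sum_congr rfl fun j _ => ?_
      rw [MulChar.mul_apply]
      ring

theorem norm_sum_prod_sum_mulChar_sub_le {F κ : Type*} [Field F] [Fintype F] [Fintype κ]
    {p n : ℕ} [CharP F p] (hn : 0 < n) (hnp : n ≤ p) {η : κ → MulChar F ℂ} {u : κ → ℂ}
    {ε : κ → ℝ} {a₀ : κ} {M : ℝ} (hη : η a₀ = 1) (hu : u a₀ = 1) (huniq : ∀ a, η a = 1 → a = a₀)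
    (hε : ∀ a, η a (-1) = ε a) (hεsum : ∑ a, ε a * ‖u a‖ = 0) (hM : ∑ a, ‖u a‖ ≤ M) :
    ‖∑ g : F, ∏ k : Fin n, ∑ a, u a * η a (g + ((k : ℕ) : F)) - (Fintype.card F - n)‖ ≤
      (M ^ n / 2 - 1) * ((n - 1) * √(Fintype.card F)) := by
  classical
  have hinj : Function.Injective fun k : Fin n => ((k : ℕ) : F) := fun i j hij =>
    Fin.ext (CharP.natCast_injOn_Iio F p (i.2.trans_le hnp) (j.2.trans_le hnp) hij)
  set S := ∑ g : F, ∏ k : Fin n, ∑ a, u a * η a (g + ((k : ℕ) : F)) with hS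
  set E : (Fin n → κ) → ℂ := fun f => ∑ g : F, ∏ k, η (f k) (g + ((k : ℕ) : F)) with hE
  have hexpand : ∀ x : κ → ℂ, ∑ g : F, ∏ k : Fin n, ∑ a, x a * η a (g + ((k : ℕ) : F)) =
      ∑ f : Fin n → κ, (∏ k, x (f k)) * E f := fun x => by
    simp_rw [hE, mul_sum]
    rw [sum_comm]
    refine sum_congr rfl fun g _ => ?_
    rw [prod_univ_sum, Fintype.piFinset_univ]
    simp_rw [prod_mul_distrib]
  have hrefl : S = ∑ g : F, ∏ k : Fin n, ∑ a, (ε a * u a) * η a (g + ((k : ℕ) : F)) := by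
    rw [hS, ← Equiv.sum_comp (Equiv.subLeft (-((n - 1 : ℕ) : F)))]
    refine sum_congr rfl fun g _ => ?_
    rw [← Equiv.prod_comp Fin.revPerm]
    refine prod_congr rfl fun k _ => sum_congr rfl fun a _ => ?_
    have : Equiv.subLeft (-((n - 1 : ℕ) : F)) g + ((Fin.revPerm k : ℕ) : F) =
        -1 * (g + ((k : ℕ) : F)) := by
      have h1 : (n - 1 : ℕ) = (Fin.revPerm k : ℕ) + k := by
        simp only [Fin.revPerm_apply, Fin.val_rev]
        lia
      rw [h1, Equiv.subLeft_apply]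
      push_cast
      ring
    rw [this, map_mul, hε]
    ring
  set C : (Fin n → κ) → ℂ := fun f => ((1 + ∏ k, ε (f k)) / 2 : ℝ) * ∏ k, u (f k) with hC
  have hSC : S = ∑ f, C f * E f := by
    have h1 := hexpand u
    have h2 := hexpand fun a => ε a * u a
    rw [← hS] at h1
    rw [← hrefl] at h2
    have : S = (S + S) / 2 := by ring
    rw [this]
    nth_rewrite 1 [h1]
    rw [h2, ← sum_add_distrib, sum_div]
    refine sum_congr rfl fun f _ => ?_
    simp only [hC, prod_mul_distrib]
    push_cast
    ring
  have hε1 : ∀ a, |ε a| ≤ 1 := fun a => by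
    have := (η a).norm_apply_le_one (-1)
    rwa [hε, Complex.norm_real] at this
  have hCnorm : ∑ f, ‖C f‖ ≤ M ^ n / 2 := by
    have h1 : ∀ f, ‖C f‖ = ((∏ k, ‖u (f k)‖) + ∏ k, ε (f k) * ‖u (f k)‖) / 2 := fun f => by
      have h2 : |∏ k, ε (f k)| ≤ 1 := by
        rw [abs_prod]
        exact prod_le_one (fun _ _ => abs_nonneg _) fun k _ => hε1 _
      rw [hC, norm_mul, Complex.norm_real, norm_prod, Real.norm_of_nonneg, prod_mul_distrib]
      · ring
      · linarith [neg_le_of_abs_le h2]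
    simp_rw [h1]
    rw [← sum_div, sum_add_distrib, ← Fintype.sum_pow (fun a => ‖u a‖),
      ← Fintype.sum_pow (fun a => ε a * ‖u a‖), hεsum,
      zero_pow hn.ne', add_zero]
    gcongr
  have hmain : C (fun _ => a₀) * E (fun _ => a₀) = Fintype.card F - n := by
    have h1 : ε a₀ = 1 := by
      have := hε a₀
      rw [hη, MulChar.one_apply isUnit_one.neg] at this
      exact_mod_cast this.symm
    have h2 : ∀ g : F, ∏ k : Fin n, (1 : MulChar F ℂ) (g + ((k : ℕ) : F)) =
        1 - if g ∈ univ.image (fun k : Fin n => -((k : ℕ) : F)) then 1 else 0 := fun g => by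
      split_ifs with h
      · obtain ⟨k, -, rfl⟩ := mem_image.mp h
        rw [prod_eq_zero (mem_univ k), sub_self]
        rw [neg_add_cancel, MulChar.map_zero]
      · rw [sub_zero]
        refine prod_eq_one fun k _ => MulChar.one_apply (isUnit_iff_ne_zero.mpr fun hk => h ?_)
        exact mem_image.mpr ⟨k, mem_univ _, (eq_neg_of_add_eq_zero_left hk).symm⟩
    have h3 : E (fun _ => a₀) = Fintype.card F - n := by
      simp only [hE, hη]
      simp_rw [h2]
      rw [sum_sub_distrib, ← sum_filter, filter_univ_mem, sum_const, sum_const, card_univ,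
        card_image_of_injective univ
          (show Function.Injective fun k : Fin n => -((k : ℕ) : F) from neg_injective.comp hinj),
        card_univ, Fintype.card_fin]
      simp
    rw [h3]
    simp [hC, h1, hu]
  have hconst : ‖C (fun _ => a₀)‖ = 1 := by
    have h1 : ε a₀ = 1 := by
      have := hε a₀
      rw [hη, MulChar.one_apply isUnit_one.neg] at this
      exact_mod_cast this.symm
    simp [hC, h1, hu]
  rw [hSC, ← add_sum_erase _ _ (mem_univ fun _ => a₀), hmain, add_sub_cancel_left]
  have hB : ∀ f ∈ univ.erase (fun _ : Fin n => a₀),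
      ‖C f * E f‖ ≤ ‖C f‖ * ((n - 1) * √(Fintype.card F)) := fun f hf => by
    rw [norm_mul]
    refine mul_le_mul_of_nonneg_left ?_ (norm_nonneg _)
    have := norm_sum_prod_mulChar_add_le hinj (χ := fun k => η (f k)) (by
      by_contra! h
      exact (mem_erase.mp hf).1 (funext fun k => huniq _ (h k)))
    rwa [Fintype.card_fin] at this
  refine (norm_sum_le_of_le _ hB).trans ?_
  rw [← sum_mul]
  have hn1 : (1 : ℝ) ≤ n := by exact_mod_cast hn
  refine mul_le_mul_of_nonneg_right ?_ (mul_nonneg (by linarith) (Real.sqrt_nonneg _))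
  rw [← add_sum_erase _ _ (mem_univ fun _ => a₀), hconst] at hCnorm
  linarith

theorem eFree_iff_forall_primeFactors {F : Type*} [Field F] {e : ℕ} (he : e ≠ 0) {g : F} :
    EFree e g ↔ g ≠ 0 ∧ ∀ l ∈ e.primeFactors, ¬∃ h, g = h ^ l := by
  refine and_congr_right fun _ => ⟨?_, ?_⟩
  · rintro hg l hl ⟨h, hh⟩
    exact (Nat.prime_of_mem_primeFactors hl).one_lt.ne'
      (hg h l (Nat.dvd_of_mem_primeFactors hl) hh)
  · intro hg h d hd hh
    by_contra hd1
    obtain ⟨l, hl, m, rfl⟩ := Nat.exists_prime_and_dvd hd1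
    refine hg l (hl.mem_primeFactors ((dvd_mul_right l m).trans hd) he) ⟨h ^ m, ?_⟩
    rw [hh, ← pow_mul, mul_comm]

open Classical in
theorem exists_mulChar_expansion_eFree {F : Type*} [Field F] [Fintype F]
    (hF : Fintype.card F % 4 = 3) {e : ℕ} (he : e ∣ Fintype.card F - 1) (heven : Even e) :
    ∃ (κ : Type) (_ : Fintype κ) (η : κ → MulChar F ℂ) (u : κ → ℂ) (ε : κ → ℝ) (a₀ : κ),
      η a₀ = 1 ∧ u a₀ = 1 ∧ (∀ a, η a = 1 → a = a₀) ∧ (∀ a, η a (-1) = ε a) ∧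
      ∑ a, ε a * ‖u a‖ = 0 ∧ ∑ a, ‖u a‖ ≤ W e ∧
      ∀ g : F, (if EFree e g then (1 : ℂ) else 0) = theta e * ∑ a, u a * η a g := by
  have hq1 : Fintype.card F - 1 ≠ 0 := by lia
  have he0 : e ≠ 0 := ne_zero_of_dvd_ne_zero hq1 he
  have h2e : 2 ∈ e.primeFactors := Nat.prime_two.mem_primeFactors heven.two_dvd he0
  obtain ⟨ι, _, χ, w, i₀, hχ, hw, huniq, hpow, hsum, hind⟩ :=
    exists_mulChar_expansion_forall_prime (F := F) (e.primeFactors.erase 2) fun l hl =>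
      have hl' := mem_of_mem_erase hl
      ⟨Nat.prime_of_mem_primeFactors hl', (Nat.dvd_of_mem_primeFactors hl').trans he⟩
  obtain ⟨ψ, hψ, hexp⟩ := exists_mulChar_expansion (F := F) Nat.prime_two
    (heven.two_dvd.trans he)
  have hodd : Odd (∏ l ∈ e.primeFactors.erase 2, l) := by
    refine prod_induction _ Odd (fun _ _ => Odd.mul) odd_one fun l hl => ?_
    exact (Nat.prime_of_mem_primeFactors (mem_of_mem_erase hl)).odd_of_ne_two (ne_of_mem_erase hl)
  have hχneg : ∀ i, χ i (-1) = 1 := fun i =>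
    (χ i).val_neg_one_eq_one_of_odd_order hodd (hpow i)
  have hψneg : ψ (-1) = -1 := by
    have h1 := hexp (-1) (neg_ne_zero.mpr one_ne_zero)
    rw [if_neg, sum_range_succ, sum_range_one, pow_zero, pow_one,
      MulChar.one_apply isUnit_one.neg] at h1
    · exact eq_neg_of_add_eq_zero_right h1
    · rw [← isSquare_iff_exists_sq, FiniteField.isSquare_neg_one_iff]
      exact fun h => h hF
  refine ⟨ι × Fin 2, inferInstance, fun a => χ a.1 * ψ ^ (a.2 : ℕ),
    fun a => w a.1 * (-1) ^ (a.2 : ℕ), fun a => (-1) ^ (a.2 : ℕ), (i₀, 0), by simp [hχ],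
    by simp [hw], ?_, ?_, ?_, ?_, ?_⟩
  · rintro ⟨i, j⟩ hij
    dsimp only at hij
    have h1 := congrArg (fun η : MulChar F ℂ => η (-1)) hij
    simp only [MulChar.mul_apply, hχneg, one_mul, MulChar.one_apply isUnit_one.neg] at h1
    fin_cases j
    · rw [huniq i (by simpa using hij)]
      rfl
    · simp [hψneg] at h1
      norm_num at h1
  · rintro ⟨i, j⟩
    fin_cases j <;> simp [MulChar.mul_apply, hχneg, hψneg]
  · simp [Fintype.sum_prod_type]
  · simp only [Fintype.sum_prod_type, norm_mul, norm_pow, norm_neg, norm_one, one_pow, mul_one,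
      sum_const, card_univ, Fintype.card_fin, ← smul_sum]
    rw [W, ← card_erase_add_one h2e, pow_succ, nsmul_eq_mul, mul_comm]
    push_cast
    gcongr
  · intro g
    by_cases hg : g = 0
    · subst hg
      simp only [EFree, ne_eq, not_true, false_and, if_false, MulChar.map_zero, mul_zero,
        sum_const_zero]
    have hsplit : (if EFree e g then (1 : ℂ) else 0) =
        (if ¬∃ h, g = h ^ 2 then (1 : ℂ) else 0) *
          if ∀ l ∈ e.primeFactors.erase 2, ¬∃ h, g = h ^ l then (1 : ℂ) else 0 := by
      rw [ite_zero_mul_ite_zero, one_mul]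
      refine if_congr ?_ rfl rfl
      rw [eFree_iff_forall_primeFactors he0, and_iff_right hg]
      conv_lhs => rw [← insert_erase h2e]
      exact forall_mem_insert _ _ _
    have hψg : (if ¬∃ h, g = h ^ 2 then (1 : ℂ) else 0) = (1 - 1 / 2) * (1 - ψ g) := by
      have h1 := hexp g hg
      rw [sum_range_succ, sum_range_one, pow_zero, pow_one,
        MulChar.one_apply (isUnit_iff_ne_zero.mpr hg)] at h1
      rw [eq_sub_of_add_eq' h1]
      by_cases h2 : ∃ h, g = h ^ 2
      · rw [if_neg (not_not.mpr h2), if_pos h2]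
        norm_num
      · rw [if_pos h2, if_neg h2]
        norm_num
    rw [hsplit, hψg, hind g hg, theta, ← mul_prod_erase _ _ h2e]
    push_cast
    rw [mul_mul_mul_comm, mul_sum, Fintype.sum_prod_type]
    congr 1
    refine sum_congr rfl fun i _ => ?_
    simp only [Fin.sum_univ_two, Fin.val_zero, Fin.val_one, pow_zero, pow_one, mul_one,
      MulChar.mul_apply, MulChar.one_apply (isUnit_iff_ne_zero.mpr hg)]
    ring

/-- For `q ≡ 3 (mod 4)`, `q ≥ 7`, `3 ≤ n ≤ p` and `e` an even divisor of `q - 1`,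
`N_n(e) ≥ θ(e)^n (q - ((n-1)/2) W(e)^n √q)`. -/
theorem Nn_lower_bound_three_mod_four (q p n : ℕ) (hq : IsPrimePow q) (hq4 : q % 4 = 3)
    (hq7 : 7 ≤ q) (F : Type*) [Field F] [Fintype F] (hF : Fintype.card F = q)
    (hp : CharP F p) (hn3 : 3 ≤ n) (hnp : n ≤ p) (e : ℕ) (he : e ∣ q - 1)
    (heven : Even e) :
    theta e ^ n * ((q : ℝ) - ((n : ℝ) - 1) / 2 * (W e : ℝ) ^ n * Real.sqrt q) ≤
      (Nn F n e : ℝ) := by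
  classical
  subst hF
  obtain ⟨κ, _, η, u, ε, a₀, hη, hu, huniq, hε, hεsum, hM, hind⟩ :=
    exists_mulChar_expansion_eFree hq4 he heven
  have hS := norm_sum_prod_sum_mulChar_sub_le (by lia) hnp hη hu huniq hε hεsum hM
  set S := ∑ g : F, ∏ k : Fin n, ∑ a, u a * η a (g + ((k : ℕ) : F))
  have hN : (Nn F n e : ℂ) = (theta e ^ n : ℝ) * S := by
    rw [Nn, Ncount, Nat.card_eq_fintype_card, Fintype.card_subtype, natCast_card_filter, mul_sum]
    refine sum_congr rfl fun g _ => ?_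
    rw [Complex.ofReal_pow, ← Fin.prod_const, ← prod_mul_distrib, ← prod_congr rfl fun k _ => hind _,
      Fintype.prod_ite_zero, prod_const_one]
    congr
  have hNre : (Nn F n e : ℝ) = theta e ^ n * S.re := by
    rw [← Complex.re_ofReal_mul, ← hN, Complex.natCast_re]
  have hθ : 0 ≤ theta e := prod_nonneg fun l hl => by
    have : (1 : ℝ) ≤ l := by exact_mod_cast (Nat.prime_of_mem_primeFactors hl).one_lt.le
    exact sub_nonneg.mpr ((div_le_one (by linarith)).mpr this)
  rw [hNre]
  refine mul_le_mul_of_nonneg_left ?_ (pow_nonneg hθ n)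
  have hre := neg_le_of_abs_le ((Complex.abs_re_le_norm _).trans hS)
  simp only [Complex.sub_re, Complex.natCast_re] at hre
  have hsqrt : 2 ≤ √(Fintype.card F : ℝ) := Real.le_sqrt_of_sq_le (by
    have : (7 : ℝ) ≤ Fintype.card F := by exact_mod_cast hq7
    linarith)
  have hn : (3 : ℝ) ≤ n := by exact_mod_cast hn3
  nlinarith
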